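/- arXiv:2409.01697 — 3 statements merged into one kernel-verified Lean document; each statement's English description precedes it below -/
import Mathlib

section
/- Suppose A₀ and A₁ are jointly positive definite, i.e., there exists μ₁ ∈ ℝ such that A₀ + μ₁A₁ is positive definite. Then: (i) if A₁ is positive semidefinite or negative semidefinite, the problem (GTRE) has at most one local-nonglobal minimizer; (ii) if A₁ is indefinite (there exist x̄, x̃ with x̄ᵀA₁x̄ < 0 < x̃ᵀA₁x̃), the problem (GTRE) has at most two local-nonglobal minimizers. -/
open Matrix Finset

/-- Euclidean norm of a vector in `Fin n → ℝ`. -/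
noncomputable def euclNorm {n : ℕ} (x : Fin n → ℝ) : ℝ := Real.sqrt (x ⬝ᵥ x)

/-- Objective `f₀(x) = xᵀA₀x + 2b₀ᵀx`. -/
noncomputable def qf0 {n : ℕ} (A0 : Matrix (Fin n) (Fin n) ℝ) (b0 : Fin n → ℝ)
    (x : Fin n → ℝ) : ℝ := x ⬝ᵥ A0.mulVec x + 2 * (b0 ⬝ᵥ x)

/-- Constraint `f₁(x) = xᵀA₁x + 2b₁ᵀx + c₁`. -/
noncomputable def qf1 {n : ℕ} (A1 : Matrix (Fin n) (Fin n) ℝ) (b1 : Fin n → ℝ) (c1 : ℝ)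
    (x : Fin n → ℝ) : ℝ := x ⬝ᵥ A1.mulVec x + 2 * (b1 ⬝ᵥ x) + c1

/-- Local minimizer of (GTRE): feasible, and locally optimal among feasible points. -/
def IsLocalMinGTRE {n : ℕ} (A0 A1 : Matrix (Fin n) (Fin n) ℝ) (b0 b1 : Fin n → ℝ) (c1 : ℝ)
    (xs : Fin n → ℝ) : Prop :=
  qf1 A1 b1 c1 xs = 0 ∧ ∃ δ > (0:ℝ), ∀ x : Fin n → ℝ,
    qf1 A1 b1 c1 x = 0 → euclNorm (x - xs) < δ → qf0 A0 b0 xs ≤ qf0 A0 b0 x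

/-- Global minimizer of (GTRE). -/
def IsGlobalMinGTRE {n : ℕ} (A0 A1 : Matrix (Fin n) (Fin n) ℝ) (b0 b1 : Fin n → ℝ) (c1 : ℝ)
    (xs : Fin n → ℝ) : Prop :=
  qf1 A1 b1 c1 xs = 0 ∧ ∀ x : Fin n → ℝ, qf1 A1 b1 c1 x = 0 → qf0 A0 b0 xs ≤ qf0 A0 b0 x

/-- Local-nonglobal minimizer of (GTRE). -/
def IsLNGMinGTRE {n : ℕ} (A0 A1 : Matrix (Fin n) (Fin n) ℝ) (b0 b1 : Fin n → ℝ) (c1 : ℝ)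
    (xs : Fin n → ℝ) : Prop :=
  IsLocalMinGTRE A0 A1 b0 b1 c1 xs ∧ ¬ IsGlobalMinGTRE A0 A1 b0 b1 c1 xs

/-- Strict local minimizer of (GTRE). -/
def IsStrictLocalMinGTRE {n : ℕ} (A0 A1 : Matrix (Fin n) (Fin n) ℝ) (b0 b1 : Fin n → ℝ)
    (c1 : ℝ) (xs : Fin n → ℝ) : Prop :=
  qf1 A1 b1 c1 xs = 0 ∧ ∃ δ > (0:ℝ), ∀ x : Fin n → ℝ,
    qf1 A1 b1 c1 x = 0 → x ≠ xs → euclNorm (x - xs) < δ → qf0 A0 b0 xs < qf0 A0 b0 x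

/-- Strict local-nonglobal minimizer of (GTRE). -/
def IsStrictLNGMinGTRE {n : ℕ} (A0 A1 : Matrix (Fin n) (Fin n) ℝ) (b0 b1 : Fin n → ℝ)
    (c1 : ℝ) (xs : Fin n → ℝ) : Prop :=
  IsStrictLocalMinGTRE A0 A1 b0 b1 c1 xs ∧ ¬ IsGlobalMinGTRE A0 A1 b0 b1 c1 xs

/-- Local minimizer of (GTR). -/
def IsLocalMinGTR {n : ℕ} (A0 A1 : Matrix (Fin n) (Fin n) ℝ) (b0 b1 : Fin n → ℝ) (c1 : ℝ)
    (xs : Fin n → ℝ) : Prop :=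
  qf1 A1 b1 c1 xs ≤ 0 ∧ ∃ δ > (0:ℝ), ∀ x : Fin n → ℝ,
    qf1 A1 b1 c1 x ≤ 0 → euclNorm (x - xs) < δ → qf0 A0 b0 xs ≤ qf0 A0 b0 x

/-- Global minimizer of (GTR). -/
def IsGlobalMinGTR {n : ℕ} (A0 A1 : Matrix (Fin n) (Fin n) ℝ) (b0 b1 : Fin n → ℝ) (c1 : ℝ)
    (xs : Fin n → ℝ) : Prop :=
  qf1 A1 b1 c1 xs ≤ 0 ∧ ∀ x : Fin n → ℝ, qf1 A1 b1 c1 x ≤ 0 → qf0 A0 b0 xs ≤ qf0 A0 b0 x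

/-- Local-nonglobal minimizer of (GTR). -/
def IsLNGMinGTR {n : ℕ} (A0 A1 : Matrix (Fin n) (Fin n) ℝ) (b0 b1 : Fin n → ℝ) (c1 : ℝ)
    (xs : Fin n → ℝ) : Prop :=
  IsLocalMinGTR A0 A1 b0 b1 c1 xs ∧ ¬ IsGlobalMinGTR A0 A1 b0 b1 c1 xs

/-- Strict local minimizer of (GTR). -/
def IsStrictLocalMinGTR {n : ℕ} (A0 A1 : Matrix (Fin n) (Fin n) ℝ) (b0 b1 : Fin n → ℝ)
    (c1 : ℝ) (xs : Fin n → ℝ) : Prop :=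
  qf1 A1 b1 c1 xs ≤ 0 ∧ ∃ δ > (0:ℝ), ∀ x : Fin n → ℝ,
    qf1 A1 b1 c1 x ≤ 0 → x ≠ xs → euclNorm (x - xs) < δ → qf0 A0 b0 xs < qf0 A0 b0 x

/-- Strict local-nonglobal minimizer of (GTR). -/
def IsStrictLNGMinGTR {n : ℕ} (A0 A1 : Matrix (Fin n) (Fin n) ℝ) (b0 b1 : Fin n → ℝ)
    (c1 : ℝ) (xs : Fin n → ℝ) : Prop :=
  IsStrictLocalMinGTR A0 A1 b0 b1 c1 xs ∧ ¬ IsGlobalMinGTR A0 A1 b0 b1 c1 xs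

open Filter Topology

section Separable

variable {ι : Type*} [Fintype ι]

/-- The quadratic function `∑ i, (a i * z i ^ 2 + 2 * β i * z i) + γ`. -/
noncomputable def sepQuad (a β : ι → ℝ) (γ : ℝ) (z : ι → ℝ) : ℝ :=
  (a * z) ⬝ᵥ z + 2 * (β ⬝ᵥ z) + γ

lemma sepQuad_add_smul (a β : ι → ℝ) (γ : ℝ) (z e : ι → ℝ) (t : ℝ) :
    sepQuad a β γ (z + t • e) =
      sepQuad a β γ z + 2 * t * ((a * z + β) ⬝ᵥ e) + t ^ 2 * ((a * e) ⬝ᵥ e) := by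
  have h : (a * e) ⬝ᵥ z = (a * z) ⬝ᵥ e := by
    simp only [dotProduct, Pi.mul_apply]
    exact Finset.sum_congr rfl fun i _ => by ring
  simp only [sepQuad, mul_add, mul_smul_comm, add_dotProduct, dotProduct_add, smul_dotProduct,
    dotProduct_smul, smul_eq_mul, h]
  ring

lemma dotProduct_self_add_smul (z e : ι → ℝ) (t : ℝ) :
    (z + t • e) ⬝ᵥ (z + t • e) = z ⬝ᵥ z + 2 * t * (z ⬝ᵥ e) + t ^ 2 * (e ⬝ᵥ e) := by
  simp only [add_dotProduct, dotProduct_add, smul_dotProduct, dotProduct_smul, smul_eq_mul,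
    dotProduct_comm e z]
  ring

/-- `z` is a local minimizer of `w ↦ w ⬝ᵥ w` on the zero set of `sepQuad a β γ`. -/
def IsSepLocalMin (a β : ι → ℝ) (γ : ℝ) (z : ι → ℝ) : Prop :=
  sepQuad a β γ z = 0 ∧ ∀ᶠ w in 𝓝 z, sepQuad a β γ w = 0 → z ⬝ᵥ z ≤ w ⬝ᵥ w

/-- `z` is a local, but not a global, minimizer of `w ↦ w ⬝ᵥ w` on the zero set of
`sepQuad a β γ`. -/
def IsSepLNGMin (a β : ι → ℝ) (γ : ℝ) (z : ι → ℝ) : Prop :=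
  IsSepLocalMin a β γ z ∧ ∃ w, sepQuad a β γ w = 0 ∧ w ⬝ᵥ w < z ⬝ᵥ z

/-- The optimality conditions at a local-nonglobal minimizer `z` with multiplier `l`. -/
structure IsSepCritical (a β : ι → ℝ) (l : ℝ) (z : ι → ℝ) : Prop where
  eq_smul : z = -l • (a * z + β)
  exists_neg : ∃ i, 1 + l * a i < 0
  nonneg : ∀ d, (a * z + β) ⬝ᵥ d = 0 → 0 ≤ l * ((a * d) ⬝ᵥ d) + d ⬝ᵥ d

lemma eq_zero_of_eventually_nonneg_mul {ψ : ℝ → ℝ} (hψ : Continuous ψ)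
    (h : ∀ᶠ t in 𝓝 (0 : ℝ), 0 ≤ t * ψ t) : ψ 0 = 0 := by
  apply le_antisymm
  · have h1 : ∀ᶠ t in 𝓝[<] (0 : ℝ), ψ t ≤ 0 := by
      filter_upwards [nhdsWithin_le_nhds h, self_mem_nhdsWithin] with t ht (ht0 : t < 0)
      by_contra! hc
      nlinarith [mul_pos_of_neg_of_neg ht0 (neg_neg_of_pos hc)]
    exact le_of_tendsto (hψ.continuousAt.tendsto.mono_left nhdsWithin_le_nhds) h1
  · have h1 : ∀ᶠ t in 𝓝[>] (0 : ℝ), 0 ≤ ψ t := by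
      filter_upwards [nhdsWithin_le_nhds h, self_mem_nhdsWithin] with t ht (ht0 : 0 < t)
      exact nonneg_of_mul_nonneg_right ht ht0
    exact ge_of_tendsto (hψ.continuousAt.tendsto.mono_left nhdsWithin_le_nhds) h1

variable {a β : ι → ℝ} {γ : ℝ} {z : ι → ℝ}

lemma IsSepLocalMin.dotProduct_eq_zero_of_line (h : IsSepLocalMin a β γ z) {d : ι → ℝ}
    (hg : (a * z + β) ⬝ᵥ d = 0) (hd : (a * d) ⬝ᵥ d = 0) : z ⬝ᵥ d = 0 := by
  have hc : Tendsto (fun t : ℝ => z + t • d) (𝓝 0) (𝓝 z) := by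
    have : Continuous fun t : ℝ => z + t • d := by fun_prop
    simpa using this.tendsto 0
  have key := eq_zero_of_eventually_nonneg_mul (ψ := fun t : ℝ => 2 * (z ⬝ᵥ d) + t * (d ⬝ᵥ d))
    (by fun_prop) <| by
    filter_upwards [hc.eventually h.2] with t ht
    have := ht (by rw [sepQuad_add_smul, hg, hd, h.1]; ring)
    rw [dotProduct_self_add_smul] at this
    linarith
  simpa using key

/-- Feasible points near `z` are obtained as the second intersection point of the quadric with
a line through `z`. -/
lemma IsSepLocalMin.eventually_nonneg (h : IsSepLocalMin a β γ z) {d : ι → ℝ}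
    (hg : (a * z + β) ⬝ᵥ d = 0) (hd : (a * d) ⬝ᵥ d ≠ 0) :
    ∀ᶠ t in 𝓝 (0 : ℝ),
      0 ≤ t * ((a * z + β) ⬝ᵥ (a * z + β)) *
        (-((a * (d + t • (a * z + β))) ⬝ᵥ (d + t • (a * z + β))) *
            (z ⬝ᵥ (d + t • (a * z + β))) +
          t * ((a * z + β) ⬝ᵥ (a * z + β)) *
            ((d + t • (a * z + β)) ⬝ᵥ (d + t • (a * z + β)))) := by
  set g := a * z + β with hgdef
  have hs : Continuous fun t : ℝ => (a * (d + t • g)) ⬝ᵥ (d + t • g) := by fun_prop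
  have hs0 : (a * (d + (0 : ℝ) • g)) ⬝ᵥ (d + (0 : ℝ) • g) ≠ 0 := by simpa using hd
  have hc : ContinuousAt (fun t : ℝ =>
      z + (-2 * (t * (g ⬝ᵥ g)) / ((a * (d + t • g)) ⬝ᵥ (d + t • g))) • (d + t • g)) 0 := by
    have h1 : ContinuousAt (fun t : ℝ =>
        -2 * (t * (g ⬝ᵥ g)) / ((a * (d + t • g)) ⬝ᵥ (d + t • g))) 0 :=
      ContinuousAt.div (by fun_prop) hs.continuousAt hs0
    have h2 : ContinuousAt (fun t : ℝ => d + t • g) 0 := by fun_prop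
    exact continuousAt_const.add (h1.smul h2)
  have hc' := hc.tendsto
  simp only [zero_mul, mul_zero, zero_div, zero_smul, add_zero] at hc'
  filter_upwards [hc'.eventually h.2, hs.continuousAt.eventually_ne hs0] with t ht hst
  set e := d + t • g with he
  set s := (a * e) ⬝ᵥ e with hsdef
  have hge : g ⬝ᵥ e = t * (g ⬝ᵥ g) := by
    rw [he, dotProduct_add, hg, dotProduct_smul, smul_eq_mul, zero_add]
  have h1 := ht (by
    rw [sepQuad_add_smul, h.1, ← hgdef, hge, ← hsdef]; field_simp; ring)
  rw [dotProduct_self_add_smul] at h1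
  have h2 : 0 ≤ (2 * (-2 * (t * (g ⬝ᵥ g)) / s) * (z ⬝ᵥ e) +
      (-2 * (t * (g ⬝ᵥ g)) / s) ^ 2 * (e ⬝ᵥ e)) * s ^ 2 := by
    apply mul_nonneg _ (sq_nonneg s)
    linarith
  have h3 : (2 * (-2 * (t * (g ⬝ᵥ g)) / s) * (z ⬝ᵥ e) +
      (-2 * (t * (g ⬝ᵥ g)) / s) ^ 2 * (e ⬝ᵥ e)) * s ^ 2 =
      4 * (t * (g ⬝ᵥ g) * (-s * (z ⬝ᵥ e) + t * (g ⬝ᵥ g) * (e ⬝ᵥ e))) := by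
    field_simp
    ring
  linarith

lemma IsSepLocalMin.dotProduct_eq_zero (h : IsSepLocalMin a β γ z) (hz : a * z + β ≠ 0)
    {d : ι → ℝ} (hg : (a * z + β) ⬝ᵥ d = 0) : z ⬝ᵥ d = 0 := by
  by_cases hd : (a * d) ⬝ᵥ d = 0
  · exact h.dotProduct_eq_zero_of_line hg hd
  set g := a * z + β with hgdef
  have key := eq_zero_of_eventually_nonneg_mul (ψ := fun t : ℝ => (g ⬝ᵥ g) *
      (-((a * (d + t • g)) ⬝ᵥ (d + t • g)) * (z ⬝ᵥ (d + t • g)) +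
        t * (g ⬝ᵥ g) * ((d + t • g) ⬝ᵥ (d + t • g)))) (by fun_prop)
    ((h.eventually_nonneg hg hd).mono fun t ht => by rwa [mul_assoc] at ht)
  simp only [zero_mul, zero_smul, add_zero, mul_eq_zero, neg_eq_zero, dotProduct_self_eq_zero]
    at key
  tauto

lemma IsSepLocalMin.exists_multiplier (h : IsSepLocalMin a β γ z) (hz : a * z + β ≠ 0) :
    ∃ l : ℝ, z = -l • (a * z + β) := by
  set g := a * z + β with hgdef
  have hgg : g ⬝ᵥ g ≠ 0 := by rwa [Ne, dotProduct_self_eq_zero]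
  have h1 : g ⬝ᵥ (z - (z ⬝ᵥ g / g ⬝ᵥ g) • g) = 0 := by
    rw [dotProduct_sub, dotProduct_smul, smul_eq_mul, div_mul_cancel₀ _ hgg,
      dotProduct_comm, sub_self]
  have h2 := h.dotProduct_eq_zero hz h1
  refine ⟨-(z ⬝ᵥ g / g ⬝ᵥ g), ?_⟩
  rw [neg_neg, ← sub_eq_zero, ← dotProduct_self_eq_zero, sub_dotProduct, h2, smul_dotProduct, h1,
    smul_zero, sub_zero]

lemma IsSepLocalMin.second_order (h : IsSepLocalMin a β γ z) (hz : a * z + β ≠ 0) {l : ℝ}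
    (hl : z = -l • (a * z + β)) {d : ι → ℝ} (hg : (a * z + β) ⬝ᵥ d = 0) :
    0 ≤ l * ((a * d) ⬝ᵥ d) + d ⬝ᵥ d := by
  by_cases hd : (a * d) ⬝ᵥ d = 0
  · rw [hd, mul_zero, zero_add]
    exact Finset.sum_nonneg fun i _ => mul_self_nonneg _
  have hev := h.eventually_nonneg hg hd
  set g := a * z + β with hgdef
  have hgg : 0 < g ⬝ᵥ g := by
    refine lt_of_le_of_ne (Finset.sum_nonneg fun i _ => mul_self_nonneg _) fun h0 => hz ?_
    exact dotProduct_self_eq_zero.1 h0.symm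
  have hcont : Continuous fun t : ℝ =>
      l * ((a * (d + t • g)) ⬝ᵥ (d + t • g)) + (d + t • g) ⬝ᵥ (d + t • g) := by fun_prop
  have hlim := hcont.continuousAt.tendsto.mono_left (nhdsWithin_le_nhds (a := 0) (s := {0}ᶜ))
  simp only [zero_smul, add_zero] at hlim
  refine ge_of_tendsto hlim ?_
  filter_upwards [nhdsWithin_le_nhds hev, self_mem_nhdsWithin] with t ht (ht0 : t ≠ 0)
  set e := d + t • g with he
  have hge : z ⬝ᵥ e = -l * (t * (g ⬝ᵥ g)) := by
    rw [hl, he, smul_dotProduct, dotProduct_add, hg, dotProduct_smul, smul_eq_mul, smul_eq_mul,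
      zero_add]
  rw [hge] at ht
  have h0 : 0 < (t * (g ⬝ᵥ g)) ^ 2 := by positivity
  refine nonneg_of_mul_nonneg_right (a := (t * (g ⬝ᵥ g)) ^ 2) ?_ h0
  linarith

lemma IsSepLNGMin.gradient_ne_zero (h : IsSepLNGMin a β γ z) : a * z + β ≠ 0 := by
  intro hz
  obtain ⟨hloc, w, hw, hlt⟩ := h
  have hw' : w = z + (1 : ℝ) • (w - z) := by simp
  rw [hw'] at hw hlt
  rw [sepQuad_add_smul, hloc.1, hz, zero_dotProduct] at hw
  have h0 := hloc.dotProduct_eq_zero_of_line (d := w - z) (by rw [hz, zero_dotProduct])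
    (by linarith)
  rw [dotProduct_self_add_smul, h0] at hlt
  have : 0 ≤ (w - z) ⬝ᵥ (w - z) := Finset.sum_nonneg fun i _ => mul_self_nonneg _
  linarith

lemma mul_dotProduct_add_dotProduct (a d : ι → ℝ) (l : ℝ) :
    l * ((a * d) ⬝ᵥ d) + d ⬝ᵥ d = ∑ i, (1 + l * a i) * d i ^ 2 := by
  simp only [dotProduct, Finset.mul_sum, ← Finset.sum_add_distrib, Pi.mul_apply]
  exact Finset.sum_congr rfl fun i _ => by ring

lemma IsSepLNGMin.exists_isSepCritical (h : IsSepLNGMin a β γ z) :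
    ∃ l, IsSepCritical a β l z := by
  have hz := h.gradient_ne_zero
  obtain ⟨hloc, w, hw, hlt⟩ := h
  obtain ⟨l, hl⟩ := hloc.exists_multiplier hz
  refine ⟨l, hl, ?_, fun d hd => hloc.second_order hz hl hd⟩
  by_contra! hc
  have hw' : w = z + (1 : ℝ) • (w - z) := by simp
  have h1 := mul_dotProduct_add_dotProduct a (w - z) l
  have h2 : 0 ≤ ∑ i, (1 + l * a i) * (w - z) i ^ 2 :=
    Finset.sum_nonneg fun i _ => mul_nonneg (hc i) (sq_nonneg _)
  rw [hw'] at hw hlt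
  rw [sepQuad_add_smul, hloc.1] at hw
  rw [dotProduct_self_add_smul] at hlt
  have h3 : z ⬝ᵥ (w - z) = -l * ((a * z + β) ⬝ᵥ (w - z)) := by
    rw [← smul_eq_mul, ← smul_dotProduct, ← hl]
  have h4 := congrArg (l * ·) hw
  simp only [mul_zero] at h4
  linarith

lemma IsSepCritical.nonneg_update [DecidableEq ι] {l : ℝ} (h : IsSepCritical a β l z) (i : ι)
    (c : ι → ℝ) (s : ℝ) (hc : (a * z + β) i * s + ∑ j ∈ univ.erase i, (a * z + β) j * c j = 0) :
    0 ≤ (1 + l * a i) * s ^ 2 + ∑ j ∈ univ.erase i, (1 + l * a j) * c j ^ 2 := by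
  have h1 := h.nonneg (Function.update c i s) (by
    rw [dotProduct, ← Finset.add_sum_erase _ _ (mem_univ i), Function.update_self, ← hc]
    congr 1
    refine Finset.sum_congr rfl fun j hj => ?_
    rw [Function.update_of_ne (Finset.ne_of_mem_erase hj)])
  rw [mul_dotProduct_add_dotProduct, ← Finset.add_sum_erase _ _ (mem_univ i),
    Function.update_self] at h1
  convert h1 using 2
  refine Finset.sum_congr rfl fun j hj => ?_
  rw [Function.update_of_ne (Finset.ne_of_mem_erase hj)]

lemma IsSepCritical.gradient_apply_ne_zero {l : ℝ} (h : IsSepCritical a β l z) {i : ι}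
    (hi : 1 + l * a i < 0) : (a * z + β) i ≠ 0 := by
  classical
  intro h0
  have := h.nonneg_update i 0 1 (by simp [h0])
  simp at this
  linarith

lemma IsSepCritical.nonneg_pair {l : ℝ} (h : IsSepCritical a β l z) {i j : ι} (hj : j ≠ i) :
    0 ≤ (1 + l * a i) * (a * z + β) j ^ 2 + (1 + l * a j) * (a * z + β) i ^ 2 := by
  classical
  have hj' : j ∈ univ.erase i := by simp [hj]
  have := h.nonneg_update i (Pi.single j (-(a * z + β) i)) ((a * z + β) j) (by
    rw [Finset.sum_eq_single_of_mem j hj' fun k _ hk => by simp [hk], Pi.single_eq_same]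
    ring)
  rw [Finset.sum_eq_single_of_mem j hj' fun k _ hk => by simp [hk], Pi.single_eq_same] at this
  linarith

lemma IsSepCritical.coeff_nonneg {l : ℝ} (h : IsSepCritical a β l z) {i j : ι}
    (hi : 1 + l * a i < 0) (hj : j ≠ i) : 0 ≤ 1 + l * a j := by
  have h1 := h.nonneg_pair hj
  have h2 := sq_pos_of_ne_zero (h.gradient_apply_ne_zero hi)
  by_contra! hc
  nlinarith [mul_neg_of_neg_of_pos hc h2,
    mul_nonpos_of_nonpos_of_nonneg hi.le (sq_nonneg ((a * z + β) j))]

lemma IsSepCritical.gradient_apply_eq_zero {l : ℝ} (h : IsSepCritical a β l z) {i j : ι}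
    (hi : 1 + l * a i < 0) (hj : 1 + l * a j = 0) : (a * z + β) j = 0 := by
  have hji : j ≠ i := by rintro rfl; linarith
  have h1 := h.nonneg_pair hji
  rw [hj, zero_mul, add_zero] at h1
  by_contra hc
  have := mul_neg_of_neg_of_pos hi (sq_pos_of_ne_zero hc)
  linarith

lemma IsSepCritical.sum_div_le [DecidableEq ι] {l : ℝ} (h : IsSepCritical a β l z) {i : ι}
    (hi : 1 + l * a i < 0) :
    ∑ j ∈ univ.erase i, (a * z + β) j ^ 2 / (1 + l * a j) ≤
      -((a * z + β) i ^ 2 / (1 + l * a i)) := by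
  have hgi := h.gradient_apply_ne_zero hi
  have hco : ∀ j ∈ univ.erase i, 0 ≤ 1 + l * a j := fun j hj =>
    h.coeff_nonneg hi (Finset.ne_of_mem_erase hj)
  set g := a * z + β with hg
  set T := ∑ j ∈ univ.erase i, g j ^ 2 / (1 + l * a j) with hT
  have hT0 : 0 ≤ T := Finset.sum_nonneg fun j hj => div_nonneg (sq_nonneg _) (hco j hj)
  have e1 : ∑ j ∈ univ.erase i, g j * (g j / (1 + l * a j)) = T :=
    Finset.sum_congr rfl fun j _ => by ring
  have e2 : ∑ j ∈ univ.erase i, (1 + l * a j) * (g j / (1 + l * a j)) ^ 2 = T := by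
    refine Finset.sum_congr rfl fun j _ => ?_
    by_cases h0 : 1 + l * a j = 0
    · simp [h0]
    · field_simp
  have h1 := h.nonneg_update i (fun j => g j / (1 + l * a j)) (-T / g i) (by
    rw [← hg, e1]; field_simp; ring)
  rw [e2] at h1
  have hg2 := sq_pos_of_ne_zero hgi
  rw [← div_neg, le_div_iff₀ (by linarith)]
  rcases hT0.eq_or_lt with h0 | h0
  · rw [← h0, zero_mul]; exact hg2.le
  · have h2 : (1 + l * a i) * (-T / g i) ^ 2 + T =
        T / g i ^ 2 * (g i ^ 2 - T * -(1 + l * a i)) := by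
      field_simp
      ring
    rw [h2] at h1
    have := nonneg_of_mul_nonneg_right h1 (by positivity)
    linarith

lemma IsSepCritical.coeff_mul_gradient {l : ℝ} (h : IsSepCritical a β l z) (i : ι) :
    (1 + l * a i) * (a * z + β) i = β i := by
  have := congrFun h.eq_smul i
  simp only [Pi.smul_apply, smul_eq_mul, Pi.add_apply, Pi.mul_apply] at this ⊢
  linear_combination a i * this

lemma IsSepCritical.eq_of_multiplier_eq {l : ℝ} {w : ι → ℝ} (hz : IsSepCritical a β l z)
    (hw : IsSepCritical a β l w) : z = w := by
  obtain ⟨i, hi⟩ := hz.exists_neg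
  suffices h : a * z + β = a * w + β by rw [hz.eq_smul, h, ← hw.eq_smul]
  ext j
  by_cases hj : 1 + l * a j = 0
  · rw [hz.gradient_apply_eq_zero hi hj, hw.gradient_apply_eq_zero hi hj]
  · exact mul_left_cancel₀ hj ((hz.coeff_mul_gradient j).trans (hw.coeff_mul_gradient j).symm)

lemma sepQuad_sub_sepQuad (a β : ι → ℝ) (γ : ℝ) (z w : ι → ℝ) :
    sepQuad a β γ w - sepQuad a β γ z =
      ∑ i, ((a * z + β) i + (a * w + β) i) * (w i - z i) := by
  simp only [sepQuad, dotProduct, Finset.mul_sum, Pi.mul_apply, Pi.add_apply]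
  rw [add_sub_add_right_eq_sub, ← Finset.sum_add_distrib, ← Finset.sum_add_distrib,
    ← Finset.sum_sub_distrib]
  exact Finset.sum_congr rfl fun i _ => by ring

/-- One coordinate of the increment of `sepQuad` between two critical points with multipliers
`l` and `m`, expressed through the gradient at the second point. -/
lemma secant_term {α b l m x y : ℝ} (hl : 1 + l * α ≠ 0) (hm : 1 + m * α ≠ 0)
    (hx : x = -l * (α * x + b)) (hy : y = -m * (α * y + b)) :
    ((α * x + b) + (α * y + b)) * (y - x) =
      (l - m) * ((α * y + b) ^ 2 / (1 + m * α) *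
        ((1 + m * α) / (1 + l * α) + ((1 + m * α) / (1 + l * α)) ^ 2)) := by
  have gx : α * x + b = b / (1 + l * α) := by
    rw [eq_div_iff hl]
    linear_combination α * hx
  have gy : α * y + b = b / (1 + m * α) := by
    rw [eq_div_iff hm]
    linear_combination α * hy
  have key : l - m = l * (1 + m * α) - m * (1 + l * α) := by ring
  rw [gx] at hx ⊢
  rw [gy] at hy ⊢
  rw [hx, hy, key]
  generalize 1 + l * α = L at *
  generalize 1 + m * α = M at *
  field_simp
  ring

lemma IsSepCritical.not_lt {l m : ℝ} {w : ι → ℝ} (hl : 0 < l) (hz : IsSepCritical a β l z)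
    (hw : IsSepCritical a β m w) (hqz : sepQuad a β γ z = 0) (hqw : sepQuad a β γ w = 0) :
    ¬ l < m := by
  classical
  intro hlm
  obtain ⟨i, hi⟩ := hz.exists_neg
  have hai : a i < 0 := by
    by_contra! hc
    nlinarith [mul_nonneg hl.le hc]
  have hmi : 1 + m * a i < 0 := by nlinarith
  have hlj : ∀ j ≠ i, 0 < 1 + l * a j := by
    intro j hj
    refine lt_of_le_of_ne (hz.coeff_nonneg hi hj) fun h0 => ?_
    have h1 := hw.coeff_nonneg hmi hj
    have : a j < 0 := by
      by_contra! hc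
      nlinarith [mul_nonneg hl.le hc]
    nlinarith
  have hsum := sepQuad_sub_sepQuad a β γ z w
  rw [hqz, hqw, sub_zero] at hsum
  set ρ : ι → ℝ := fun j => (1 + m * a j) / (1 + l * a j) with hρ
  set q : ι → ℝ := fun j => (a * w + β) j ^ 2 / (1 + m * a j) with hq
  have hterm : ∀ j, ((a * z + β) j + (a * w + β) j) * (w j - z j) =
      (l - m) * (q j * (ρ j + ρ j ^ 2)) := by
    intro j
    have hx := congrFun hz.eq_smul j
    have hy := congrFun hw.eq_smul j
    have hlj0 : 1 + l * a j ≠ 0 := by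
      by_cases hji : j = i
      · rw [hji]; exact hi.ne
      · exact (hlj j hji).ne'
    by_cases hmj : 1 + m * a j = 0
    · have h1 := hw.gradient_apply_eq_zero hmi hmj
      have h2 : β j = 0 := by rw [← hw.coeff_mul_gradient j, h1, mul_zero]
      have h3 : (a * z + β) j = 0 := by
        have := hz.coeff_mul_gradient j
        rw [h2] at this
        exact (mul_eq_zero.1 this).resolve_left hlj0
      rw [hq]
      dsimp only
      rw [h1, h3]
      ring
    · exact secant_term hlj0 hmj hx hy
  simp_rw [hterm] at hsum
  rw [← Finset.mul_sum, eq_comm, mul_eq_zero, or_iff_right (by linarith),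
    ← Finset.add_sum_erase _ _ (mem_univ i)] at hsum
  have hρi : 0 < ρ i := div_pos_of_neg_of_neg hmi hi
  have hqi : q i < 0 := div_neg_of_pos_of_neg
    (sq_pos_of_ne_zero (hw.gradient_apply_ne_zero hmi)) hmi
  have hq0 : ∀ j ∈ univ.erase i, 0 ≤ q j := fun j hj =>
    div_nonneg (sq_nonneg _) (hw.coeff_nonneg hmi (Finset.ne_of_mem_erase hj))
  have hlt : ∀ j ∈ univ.erase i, ρ j + ρ j ^ 2 < ρ i + ρ i ^ 2 := by
    intro j hj
    have hji := Finset.ne_of_mem_erase hj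
    have h0 : 0 ≤ ρ j := div_nonneg (hw.coeff_nonneg hmi hji) (hlj j hji).le
    have haij : a i < a j := by nlinarith [hlj j hji]
    have h1 : ρ j < ρ i := by
      rw [hρ]
      dsimp only
      rw [← neg_div_neg_eq (1 + m * a i), div_lt_div_iff₀ (hlj j hji) (by linarith)]
      nlinarith [mul_pos (sub_pos.2 hlm) (sub_pos.2 haij)]
    nlinarith
  have hT : ∑ j ∈ univ.erase i, q j ≤ -q i := hw.sum_div_le hmi
  have hK : 0 < ρ i + ρ i ^ 2 := by positivity
  by_cases hall : ∀ j ∈ univ.erase i, q j = 0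
  · rw [Finset.sum_eq_zero fun j hj => by rw [hall j hj, zero_mul], add_zero] at hsum
    have := mul_neg_of_neg_of_pos hqi hK
    linarith
  · push Not at hall
    obtain ⟨j, hj, hqj⟩ := hall
    have h1 : ∑ j ∈ univ.erase i, q j * (ρ j + ρ j ^ 2) <
        ∑ j ∈ univ.erase i, q j * (ρ i + ρ i ^ 2) :=
      Finset.sum_lt_sum (fun k hk => mul_le_mul_of_nonneg_left (hlt k hk).le (hq0 k hk))
        ⟨j, hj, mul_lt_mul_of_pos_left (hlt j hj) (lt_of_le_of_ne (hq0 j hj) hqj.symm)⟩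
    rw [← Finset.sum_mul] at h1
    nlinarith [mul_le_mul_of_nonneg_right hT hK.le]

lemma IsSepCritical.eq_of_pos {l m : ℝ} {w : ι → ℝ} (hl : 0 < l) (hm : 0 < m)
    (hz : IsSepCritical a β l z) (hw : IsSepCritical a β m w)
    (hqz : sepQuad a β γ z = 0) (hqw : sepQuad a β γ w = 0) : z = w := by
  obtain rfl : l = m := le_antisymm (_root_.not_lt.1 (hw.not_lt hm hz hqw hqz))
    (_root_.not_lt.1 (hz.not_lt hl hw hqz hqw))
  exact hz.eq_of_multiplier_eq hw

lemma sepQuad_neg (a β : ι → ℝ) (γ : ℝ) (z : ι → ℝ) :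
    sepQuad (-a) (-β) (-γ) z = -sepQuad a β γ z := by
  simp only [sepQuad, neg_mul, neg_dotProduct]
  ring

lemma IsSepCritical.neg {l : ℝ} (h : IsSepCritical a β l z) :
    IsSepCritical (-a) (-β) (-l) z := by
  have hg : -a * z + -β = -(a * z + β) := by ring
  refine ⟨?_, ?_, fun d hd => ?_⟩
  · rw [hg, smul_neg, neg_neg, ← neg_smul]
    exact h.eq_smul
  · simpa using h.exists_neg
  · rw [hg, neg_dotProduct, neg_eq_zero] at hd
    simpa using h.nonneg d hd

lemma IsSepCritical.eq_of_neg {l m : ℝ} {w : ι → ℝ} (hl : l < 0) (hm : m < 0)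
    (hz : IsSepCritical a β l z) (hw : IsSepCritical a β m w)
    (hqz : sepQuad a β γ z = 0) (hqw : sepQuad a β γ w = 0) : z = w :=
  hz.neg.eq_of_pos (γ := -γ) (neg_pos.2 hl) (neg_pos.2 hm) hw.neg
    (by rw [sepQuad_neg, hqz, neg_zero]) (by rw [sepQuad_neg, hqw, neg_zero])

lemma IsSepCritical.multiplier_ne_zero {l : ℝ} (h : IsSepCritical a β l z) : l ≠ 0 := by
  rintro rfl
  obtain ⟨i, hi⟩ := h.exists_neg
  linarith

end Separable

section Diagonalization

variable {n : ℕ}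

lemma exists_orthogonal_diagonalization {M : Matrix (Fin n) (Fin n) ℝ} (hM : M.IsHermitian) :
    ∃ U : Matrix (Fin n) (Fin n) ℝ, Uᵀ * U = 1 ∧ Uᵀ * M * U = diagonal hM.eigenvalues := by
  refine ⟨hM.eigenvectorUnitary, ?_, ?_⟩
  · have := Unitary.coe_star_mul_self hM.eigenvectorUnitary
    rwa [star_eq_conjTranspose, conjTranspose_eq_transpose_of_trivial] at this
  · have := hM.conjStarAlgAut_star_eigenvectorUnitary
    rw [Unitary.conjStarAlgAut_star_apply, star_eq_conjTranspose,
      conjTranspose_eq_transpose_of_trivial] at this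
    exact this

/-- Simultaneous diagonalization by congruence of a positive definite and a symmetric matrix. -/
lemma exists_simultaneous_diagonalization {P M : Matrix (Fin n) (Fin n) ℝ} (hP : P.PosDef)
    (hM : M.IsSymm) :
    ∃ (S T : Matrix (Fin n) (Fin n) ℝ) (a : Fin n → ℝ),
      S * T = 1 ∧ Sᵀ * P * S = 1 ∧ Sᵀ * M * S = diagonal a := by
  obtain ⟨V, -, hV⟩ := exists_orthogonal_diagonalization hP.1
  set d := hP.1.eigenvalues
  have hdpos : ∀ i, 0 < d i := hP.eigenvalues_pos
  set D : Matrix (Fin n) (Fin n) ℝ := diagonal fun i => (√(d i))⁻¹ with hD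
  have hW : (V * D)ᵀ * P * (V * D) = 1 := by
    calc (V * D)ᵀ * P * (V * D) = D * (Vᵀ * P * V) * D := by
          rw [transpose_mul, hD, diagonal_transpose]; noncomm_ring
      _ = 1 := by
          rw [hV, hD, diagonal_mul_diagonal, diagonal_mul_diagonal, ← diagonal_one]
          congr 1
          ext i
          have h1 := Real.sqrt_pos.2 (hdpos i)
          have h2 := Real.mul_self_sqrt (hdpos i).le
          field_simp
          nlinarith
  have hM' : ((V * D)ᵀ * M * (V * D)).IsHermitian := by
    rw [IsHermitian, conjTranspose_eq_transpose_of_trivial]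
    simp only [transpose_mul, transpose_transpose, hM.eq, Matrix.mul_assoc]
  obtain ⟨U, hU1, hU⟩ := exists_orthogonal_diagonalization hM'
  set S := V * D * U with hS
  have hSP : Sᵀ * P * S = 1 := by
    calc Sᵀ * P * S = Uᵀ * ((V * D)ᵀ * P * (V * D)) * U := by
          rw [hS, transpose_mul]; noncomm_ring
      _ = 1 := by rw [hW, Matrix.mul_one, hU1]
  refine ⟨S, Sᵀ * P, hM'.eigenvalues, mul_eq_one_comm.1 hSP, hSP, ?_⟩
  rw [← hU, hS, transpose_mul]
  noncomm_ring

lemma quadratic_comp_affine {M : Matrix (Fin n) (Fin n) ℝ} (hM : M.IsSymm) (b s : Fin n → ℝ)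
    (S : Matrix (Fin n) (Fin n) ℝ) (z : Fin n → ℝ) :
    (S *ᵥ z + s) ⬝ᵥ M *ᵥ (S *ᵥ z + s) + 2 * (b ⬝ᵥ (S *ᵥ z + s)) =
      z ⬝ᵥ (Sᵀ * M * S) *ᵥ z + 2 * ((Sᵀ *ᵥ (M *ᵥ s + b)) ⬝ᵥ z) +
        (s ⬝ᵥ M *ᵥ s + 2 * (b ⬝ᵥ s)) := by
  have h1 : z ⬝ᵥ (Sᵀ * M * S) *ᵥ z = (S *ᵥ z) ⬝ᵥ M *ᵥ (S *ᵥ z) := by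
    rw [← mulVec_mulVec, ← mulVec_mulVec, dotProduct_mulVec, vecMul_transpose]
  have h2 : (Sᵀ *ᵥ (M *ᵥ s + b)) ⬝ᵥ z = (M *ᵥ s + b) ⬝ᵥ (S *ᵥ z) := by
    rw [dotProduct_mulVec, mulVec_transpose]
  have h3 : s ⬝ᵥ M *ᵥ (S *ᵥ z) = (M *ᵥ s) ⬝ᵥ (S *ᵥ z) := by
    rw [dotProduct_mulVec, ← mulVec_transpose, hM.eq]
  rw [h1, h2, mulVec_add, add_dotProduct, add_dotProduct, dotProduct_add, dotProduct_add,
    dotProduct_add, h3, dotProduct_comm (S *ᵥ z) (M *ᵥ s)]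
  ring

lemma IsLocalMinGTRE.eventually_le {A0 A1 : Matrix (Fin n) (Fin n) ℝ} {b0 b1 : Fin n → ℝ}
    {c1 : ℝ} {x : Fin n → ℝ} (h : IsLocalMinGTRE A0 A1 b0 b1 c1 x) :
    ∀ᶠ y in 𝓝 x, qf1 A1 b1 c1 y = 0 → qf0 A0 b0 x ≤ qf0 A0 b0 y := by
  obtain ⟨-, δ, hδ, hmin⟩ := h
  have hc : Continuous fun y : Fin n → ℝ => euclNorm (y - x) := by
    unfold euclNorm
    fun_prop
  have h0 : euclNorm (x - x) < δ := by simpa [euclNorm] using hδ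
  filter_upwards [hc.continuousAt.eventually_lt continuousAt_const h0] with y hy hy1
  exact hmin y hy1 hy

/-- An affine change of variables turns the problem into the one of minimizing the distance to
the origin on a quadric in diagonal form. -/
lemma exists_affine_isSepLNGMin {A0 A1 : Matrix (Fin n) (Fin n) ℝ} (hA0 : A0.IsSymm)
    (hA1 : A1.IsSymm) (b0 b1 : Fin n → ℝ) (c1 : ℝ) {μ : ℝ} (hP : (A0 + μ • A1).PosDef) :
    ∃ (S : Matrix (Fin n) (Fin n) ℝ) (s a β : Fin n → ℝ) (γ : ℝ),
      Sᵀ * A1 * S = diagonal a ∧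
      ∀ x, IsLNGMinGTRE A0 A1 b0 b1 c1 x →
        ∃ z, x = S *ᵥ z + s ∧ IsSepLNGMin a β γ z := by
  obtain ⟨S, T, a, hST, hSP, hSA⟩ := exists_simultaneous_diagonalization hP hA1
  have hPs : (A0 + μ • A1).IsSymm := hA0.add (hA1.smul μ)
  set P := A0 + μ • A1 with hPdef
  set s := -(P⁻¹ *ᵥ (b0 + μ • b1)) with hs
  have hPinv : P *ᵥ s + (b0 + μ • b1) = 0 := by
    rw [hs, mulVec_neg, mulVec_mulVec, mul_nonsing_inv _ ((isUnit_iff_isUnit_det _).1 hP.isUnit),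
      one_mulVec, neg_add_cancel]
  have hf1 : ∀ z, qf1 A1 b1 c1 (S *ᵥ z + s) =
      sepQuad a (Sᵀ *ᵥ (A1 *ᵥ s + b1)) (qf1 A1 b1 c1 s) z := by
    intro z
    rw [qf1, quadratic_comp_affine hA1, hSA, sepQuad, qf1, dotProduct_comm (a * z)]
    have : diagonal a *ᵥ z = a * z := by ext i; simp [mulVec_diagonal]
    rw [this]
    ring
  have hf0 : ∀ z, qf0 A0 b0 (S *ᵥ z + s) + μ * qf1 A1 b1 c1 (S *ᵥ z + s) =
      z ⬝ᵥ z + (s ⬝ᵥ P *ᵥ s + 2 * ((b0 + μ • b1) ⬝ᵥ s) + μ * c1) := by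
    intro z
    have h := quadratic_comp_affine hPs (b0 + μ • b1) s S z
    rw [hSP, hPinv, mulVec_zero, zero_dotProduct, one_mulVec] at h
    have h2 : ∀ y, qf0 A0 b0 y + μ * qf1 A1 b1 c1 y =
        y ⬝ᵥ P *ᵥ y + 2 * ((b0 + μ • b1) ⬝ᵥ y) + μ * c1 := by
      intro y
      rw [qf0, qf1, hPdef]
      simp only [add_mulVec, smul_mulVec, dotProduct_add, add_dotProduct, smul_dotProduct,
        dotProduct_smul, smul_eq_mul]
      ring
    rw [h2, h]
    ring
  refine ⟨S, s, a, Sᵀ *ᵥ (A1 *ᵥ s + b1), qf1 A1 b1 c1 s, hSA, fun x hx => ?_⟩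
  have hsurj : ∀ y, S *ᵥ (T *ᵥ (y - s)) + s = y := fun y => by
    rw [mulVec_mulVec, hST, one_mulVec, sub_add_cancel]
  obtain ⟨hloc, hng⟩ := hx
  obtain ⟨z, rfl⟩ : ∃ z, x = S *ᵥ z + s := ⟨T *ᵥ (x - s), (hsurj x).symm⟩
  have hz := hloc.1
  refine ⟨z, rfl, ⟨by rw [← hf1, hz], ?_⟩, ?_⟩
  · have hc : Continuous fun w : Fin n → ℝ => S *ᵥ w + s := by fun_prop
    filter_upwards [hc.continuousAt.tendsto.eventually hloc.eventually_le] with w hw hqw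
    rw [← hf1] at hqw
    have h1 := hf0 w
    have h2 := hf0 z
    rw [hqw] at h1
    rw [hz] at h2
    linarith [hw hqw]
  · simp only [IsGlobalMinGTRE, hz, true_and, not_forall, not_le] at hng
    obtain ⟨y, hy, hlt⟩ := hng
    obtain ⟨w, rfl⟩ : ∃ w, y = S *ᵥ w + s := ⟨T *ᵥ (y - s), (hsurj y).symm⟩
    refine ⟨w, by rw [← hf1, hy], ?_⟩
    have h1 := hf0 w
    have h2 := hf0 z
    rw [hy] at h1
    rw [hz] at h2
    linarith

end Diagonalization

theorem stmt14 {n : ℕ} (hn : 1 ≤ n)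
    (A0 A1 : Matrix (Fin n) (Fin n) ℝ) (hA0 : A0.IsSymm) (hA1 : A1.IsSymm)
    (b0 b1 : Fin n → ℝ) (c1 : ℝ)
    (hjoint : ∃ μ1 : ℝ, (A0 + μ1 • A1).PosDef) :
    ((A1.PosSemidef ∨ (-A1).PosSemidef) →
       ∀ x y : Fin n → ℝ, IsLNGMinGTRE A0 A1 b0 b1 c1 x →
         IsLNGMinGTRE A0 A1 b0 b1 c1 y → x = y) ∧
    ((∃ xb xt : Fin n → ℝ, xb ⬝ᵥ A1.mulVec xb < 0 ∧ 0 < xt ⬝ᵥ A1.mulVec xt) →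
       ∃ a b : Fin n → ℝ, ∀ x : Fin n → ℝ,
         IsLNGMinGTRE A0 A1 b0 b1 c1 x → x = a ∨ x = b) := by
  obtain ⟨μ, hP⟩ := hjoint
  obtain ⟨S, s, a, β, γ, hS, hred⟩ := exists_affine_isSepLNGMin hA0 hA1 b0 b1 c1 hP
  have hcrit : ∀ x, IsLNGMinGTRE A0 A1 b0 b1 c1 x → ∃ z l, x = S *ᵥ z + s ∧
      sepQuad a β γ z = 0 ∧ IsSepCritical a β l z := by
    intro x hx
    obtain ⟨z, hxz, hz⟩ := hred x hx
    obtain ⟨l, hl⟩ := hz.exists_isSepCritical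
    exact ⟨z, l, hxz, hz.1.1, hl⟩
  constructor
  · intro hdef x y hx hy
    obtain ⟨z, l, rfl, hqz, hz⟩ := hcrit x hx
    obtain ⟨w, m, rfl, hqw, hw⟩ := hcrit y hy
    obtain ⟨i, hi⟩ := hz.exists_neg
    obtain ⟨j, hj⟩ := hw.exists_neg
    suffices z = w by rw [this]
    rcases hdef with h | h
    · have ha : ∀ k, 0 ≤ a k := fun k => by
        have := (h.conjTranspose_mul_mul_same S).diag_nonneg (i := k)
        rwa [conjTranspose_eq_transpose_of_trivial, hS, diagonal_apply_eq] at this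
      exact hz.eq_of_neg (by nlinarith [ha i]) (by nlinarith [ha j]) hw hqz hqw
    · have ha : ∀ k, a k ≤ 0 := fun k => by
        have := (h.conjTranspose_mul_mul_same S).diag_nonneg (i := k)
        rwa [conjTranspose_eq_transpose_of_trivial, Matrix.mul_neg, Matrix.neg_mul, hS,
          Matrix.neg_apply, diagonal_apply_eq, neg_nonneg] at this
      exact hz.eq_of_pos (by nlinarith [ha i]) (by nlinarith [ha j]) hw hqz hqw
  · intro _
    let Z : Set (Fin n → ℝ) := {z | sepQuad a β γ z = 0 ∧ ∃ l > 0, IsSepCritical a β l z}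
    let W : Set (Fin n → ℝ) := {z | sepQuad a β γ z = 0 ∧ ∃ l < 0, IsSepCritical a β l z}
    have hZ : Z.Subsingleton := fun z hz w hw => by
      obtain ⟨hqz, l, hl, hz⟩ := hz
      obtain ⟨hqw, m, hm, hw⟩ := hw
      exact hz.eq_of_pos hl hm hw hqz hqw
    have hW : W.Subsingleton := fun z hz w hw => by
      obtain ⟨hqz, l, hl, hz⟩ := hz
      obtain ⟨hqw, m, hm, hw⟩ := hw
      exact hz.eq_of_neg hl hm hw hqz hqw
    obtain ⟨p, hp⟩ : ∃ p, Z ⊆ {p} := by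
      rcases hZ.eq_empty_or_singleton with h | ⟨p, h⟩
      · exact ⟨0, by simp [h]⟩
      · exact ⟨p, h.subset⟩
    obtain ⟨q, hq⟩ : ∃ q, W ⊆ {q} := by
      rcases hW.eq_empty_or_singleton with h | ⟨q, h⟩
      · exact ⟨0, by simp [h]⟩
      · exact ⟨q, h.subset⟩
    refine ⟨S *ᵥ p + s, S *ᵥ q + s, fun x hx => ?_⟩
    obtain ⟨z, l, rfl, hqz, hz⟩ := hcrit x hx
    rcases hz.multiplier_ne_zero.lt_or_gt with hl | hl
    · have hzq : z = q := hq ⟨hqz, l, hl, hz⟩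
      exact Or.inr (by rw [hzq])
    · have hzp : z = p := hp ⟨hqz, l, hl, hz⟩
      exact Or.inl (by rw [hzp])
end

section
/- Suppose n ≥ 2. For y* ∈ ℝⁿ and η* > 0, the point y* is a local-nonglobal minimizer of problem (P−) satisfying the stationarity condition (−I + (1/η*)A)y* + (1/η*)b = 0 if and only if max{λ₁, 0} < η* < λ₂, r₁ ≠ 0, y* = y₃(η*), ψ₃(η*) = 0 and ψ₃′(η*) < 0. -/
open Matrix Finset

/-- The quadratic constraint `g(y) = yᵀAy + 2bᵀy + c`. -/
noncomputable def gq {n : ℕ} (A : Matrix (Fin n) (Fin n) ℝ) (b : Fin n → ℝ) (c : ℝ)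
    (y : Fin n → ℝ) : ℝ := y ⬝ᵥ A.mulVec y + 2 * (b ⬝ᵥ y) + c

/-- Local-nonglobal minimizer of problem (P+): minimize `‖y‖²` subject to `g(y) = 0`. -/
def IsLNGMinPplus {n : ℕ} (A : Matrix (Fin n) (Fin n) ℝ) (b : Fin n → ℝ) (c : ℝ)
    (ys : Fin n → ℝ) : Prop :=
  (gq A b c ys = 0 ∧ ∃ δ > (0:ℝ), ∀ y : Fin n → ℝ,
      gq A b c y = 0 → euclNorm (y - ys) < δ → ys ⬝ᵥ ys ≤ y ⬝ᵥ y) ∧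
  ¬ (∀ y : Fin n → ℝ, gq A b c y = 0 → ys ⬝ᵥ ys ≤ y ⬝ᵥ y)

/-- Local-nonglobal minimizer of problem (P−): minimize `−‖y‖²` subject to `g(y) = 0`. -/
def IsLNGMinPminus {n : ℕ} (A : Matrix (Fin n) (Fin n) ℝ) (b : Fin n → ℝ) (c : ℝ)
    (ys : Fin n → ℝ) : Prop :=
  (gq A b c ys = 0 ∧ ∃ δ > (0:ℝ), ∀ y : Fin n → ℝ,
      gq A b c y = 0 → euclNorm (y - ys) < δ → -(ys ⬝ᵥ ys) ≤ -(y ⬝ᵥ y)) ∧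
  ¬ (∀ y : Fin n → ℝ, gq A b c y = 0 → -(ys ⬝ᵥ ys) ≤ -(y ⬝ᵥ y))

/-- `y₃(η) = −∑ᵢ (rᵢ/(λᵢ−η)) vᵢ`. -/
noncomputable def yThree {n : ℕ} (lam : Fin n → ℝ) (v : Fin n → Fin n → ℝ) (b : Fin n → ℝ)
    (η : ℝ) : Fin n → ℝ :=
  -∑ i : Fin n, ((v i ⬝ᵥ b) / (lam i - η)) • v i

/-- `ψ₃(η) = ∑ᵢ λᵢrᵢ²/(λᵢ−η)² − ∑ᵢ 2rᵢ²/(λᵢ−η) + c`. -/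
noncomputable def psiThree {n : ℕ} (lam : Fin n → ℝ) (v : Fin n → Fin n → ℝ) (b : Fin n → ℝ)
    (c : ℝ) (η : ℝ) : ℝ :=
  (∑ i : Fin n, lam i * (v i ⬝ᵥ b) ^ 2 / (lam i - η) ^ 2) -
    (∑ i : Fin n, 2 * (v i ⬝ᵥ b) ^ 2 / (lam i - η)) + c

/-- `ψ₃′(η) = 2η ∑ᵢ rᵢ²/(λᵢ−η)³`. -/
noncomputable def psiThree' {n : ℕ} (lam : Fin n → ℝ) (v : Fin n → Fin n → ℝ) (b : Fin n → ℝ)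
    (η : ℝ) : ℝ :=
  2 * η * ∑ i : Fin n, (v i ⬝ᵥ b) ^ 2 / (lam i - η) ^ 3

open Filter Topology

section Eigenbasis

variable {n : ℕ} {A : Matrix (Fin n) (Fin n) ℝ} {lam : Fin n → ℝ} {v : Fin n → Fin n → ℝ}

theorem dotProduct_eq_sum_coord
    (horth : ∀ i j : Fin n, v i ⬝ᵥ v j = if i = j then (1 : ℝ) else 0) (x y : Fin n → ℝ) :
    x ⬝ᵥ y = ∑ i, (v i ⬝ᵥ x) * (v i ⬝ᵥ y) := by
  have h : Matrix.of v * (Matrix.of v)ᵀ = 1 := by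
    ext i j
    simpa [Matrix.mul_apply, dotProduct, Matrix.one_apply] using horth i j
  have h' : (Matrix.of v)ᵀ * Matrix.of v = 1 := mul_eq_one_comm.mp h
  calc x ⬝ᵥ y = x ⬝ᵥ ((Matrix.of v)ᵀ * Matrix.of v) *ᵥ y := by rw [h', one_mulVec]
    _ = (Matrix.of v *ᵥ x) ⬝ᵥ (Matrix.of v *ᵥ y) := by
      rw [← mulVec_mulVec, dotProduct_mulVec, vecMul_transpose]
    _ = _ := rfl

theorem eq_of_coord_eq
    (horth : ∀ i j : Fin n, v i ⬝ᵥ v j = if i = j then (1 : ℝ) else 0) {x y : Fin n → ℝ}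
    (h : ∀ i, v i ⬝ᵥ x = v i ⬝ᵥ y) : x = y := by
  rw [← sub_eq_zero, ← dotProduct_self_eq_zero, dotProduct_eq_sum_coord horth]
  simp [dotProduct_sub, h]

theorem coord_sum_smul
    (horth : ∀ i j : Fin n, v i ⬝ᵥ v j = if i = j then (1 : ℝ) else 0) (a : Fin n → ℝ)
    (i : Fin n) : v i ⬝ᵥ (∑ j, a j • v j) = a i := by
  simp [dotProduct_sum, horth]

theorem dotProduct_mulVec_comm_of_isSymm (hA : A.IsSymm) (x y : Fin n → ℝ) :
    x ⬝ᵥ A *ᵥ y = y ⬝ᵥ A *ᵥ x := by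
  rw [dotProduct_mulVec, ← mulVec_transpose, hA.eq, dotProduct_comm]

theorem coord_mulVec (hA : A.IsSymm) (heig : ∀ i : Fin n, A *ᵥ v i = lam i • v i)
    (x : Fin n → ℝ) (i : Fin n) : v i ⬝ᵥ A *ᵥ x = lam i * (v i ⬝ᵥ x) := by
  rw [dotProduct_mulVec_comm_of_isSymm hA, heig, dotProduct_smul, dotProduct_comm, smul_eq_mul]

theorem sub_eq_sum_coord (hA : A.IsSymm)
    (horth : ∀ i j : Fin n, v i ⬝ᵥ v j = if i = j then (1 : ℝ) else 0)
    (heig : ∀ i : Fin n, A *ᵥ v i = lam i • v i) (η : ℝ) (x y : Fin n → ℝ) :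
    x ⬝ᵥ A *ᵥ y - η * (x ⬝ᵥ y) =
      ∑ i, (lam i - η) * ((v i ⬝ᵥ x) * (v i ⬝ᵥ y)) := by
  rw [dotProduct_eq_sum_coord horth x (A *ᵥ y), dotProduct_eq_sum_coord horth x y, mul_sum,
    ← sum_sub_distrib]
  refine sum_congr rfl fun i _ => ?_
  rw [coord_mulVec hA heig]
  ring

theorem coord_yThree
    (horth : ∀ i j : Fin n, v i ⬝ᵥ v j = if i = j then (1 : ℝ) else 0) (b : Fin n → ℝ)
    (η : ℝ) (i : Fin n) : v i ⬝ᵥ yThree lam v b η = -((v i ⬝ᵥ b) / (lam i - η)) := by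
  rw [yThree, dotProduct_neg, coord_sum_smul horth fun j => (v j ⬝ᵥ b) / (lam j - η)]

theorem gq_yThree (hA : A.IsSymm)
    (horth : ∀ i j : Fin n, v i ⬝ᵥ v j = if i = j then (1 : ℝ) else 0)
    (heig : ∀ i : Fin n, A *ᵥ v i = lam i • v i) (b : Fin n → ℝ) (c η : ℝ) :
    gq A b c (yThree lam v b η) = psiThree lam v b c η := by
  rw [gq, psiThree, dotProduct_eq_sum_coord horth _ (A *ᵥ _), dotProduct_eq_sum_coord horth b,
    mul_sum, sub_eq_add_neg, ← sum_neg_distrib]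
  congr 2 <;> refine sum_congr rfl fun i _ => ?_
  · rw [coord_mulVec hA heig, coord_yThree horth, div_eq_mul_inv, div_eq_mul_inv, ← inv_pow]
    ring
  · rw [coord_yThree horth]
    ring

theorem stationary_iff {b y : Fin n → ℝ} {η : ℝ} (hη : 0 < η) :
    (-(1 : Matrix (Fin n) (Fin n) ℝ) + (1 / η) • A) *ᵥ y + (1 / η) • b = 0 ↔
      A *ᵥ y + b = η • y := by
  have h : (-(1 : Matrix (Fin n) (Fin n) ℝ) + (1 / η) • A) *ᵥ y + (1 / η) • b =
      (1 / η) • (A *ᵥ y + b - η • y) := by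
    rw [add_mulVec, neg_mulVec, one_mulVec, smul_mulVec, smul_sub, smul_add, smul_smul,
      one_div_mul_cancel hη.ne', one_smul]
    abel
  rw [h, smul_eq_zero, sub_eq_zero, or_iff_right (one_div_pos.mpr hη).ne']

theorem stationary_iff_eq_yThree (hA : A.IsSymm)
    (horth : ∀ i j : Fin n, v i ⬝ᵥ v j = if i = j then (1 : ℝ) else 0)
    (heig : ∀ i : Fin n, A *ᵥ v i = lam i • v i) {b y : Fin n → ℝ} {η : ℝ}
    (hne : ∀ i, lam i - η ≠ 0) :
    A *ᵥ y + b = η • y ↔ y = yThree lam v b η := by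
  have key (i : Fin n) : v i ⬝ᵥ (A *ᵥ y + b) = v i ⬝ᵥ η • y ↔
      v i ⬝ᵥ y = v i ⬝ᵥ yThree lam v b η := by
    rw [coord_yThree horth, dotProduct_add, coord_mulVec hA heig, dotProduct_smul, smul_eq_mul,
      ← neg_div, eq_div_iff (hne i)]
    constructor <;> intro h <;> linarith
  exact ⟨fun h => eq_of_coord_eq horth fun i => (key i).mp (by rw [h]),
    fun h => eq_of_coord_eq horth fun i => (key i).mpr (by rw [← h])⟩

theorem psiThree'_neg_iff
    (horth : ∀ i j : Fin n, v i ⬝ᵥ v j = if i = j then (1 : ℝ) else 0) {b y : Fin n → ℝ} {η : ℝ}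
    (hη : 0 < η) (hne : ∀ i, lam i - η ≠ 0) (hy : y = yThree lam v b η) :
    psiThree' lam v b η < 0 ↔ ∑ i, (v i ⬝ᵥ y) ^ 2 / (lam i - η) < 0 := by
  have h : ∑ i, (v i ⬝ᵥ y) ^ 2 / (lam i - η) = ∑ i, (v i ⬝ᵥ b) ^ 2 / (lam i - η) ^ 3 := by
    refine sum_congr rfl fun i _ => ?_
    have := hne i
    rw [hy, coord_yThree horth]
    field_simp
  rw [psiThree', h]
  exact ⟨fun h => neg_of_mul_neg_right h (by positivity),
    fun h => mul_neg_of_pos_of_neg (by positivity) h⟩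

end Eigenbasis

section LocalMinimizer

variable {n : ℕ} {A : Matrix (Fin n) (Fin n) ℝ}

theorem continuous_euclNorm : Continuous (euclNorm (n := n)) := by
  unfold euclNorm
  fun_prop

theorem euclNorm_zero : euclNorm (0 : Fin n → ℝ) = 0 := by simp [euclNorm]

theorem dotProduct_self_nonneg (x : Fin n → ℝ) : 0 ≤ x ⬝ᵥ x :=
  sum_nonneg fun i _ => mul_self_nonneg (x i)

theorem euclNorm_sq (x : Fin n → ℝ) : euclNorm x ^ 2 = x ⬝ᵥ x :=
  Real.sq_sqrt (dotProduct_self_nonneg x)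

/-- In terms of the displacement `d = y - ys` from a stationary point, the constraint is
`dᵀAd + 2η ysᵀd = 0`, and on the feasible set the objective increases by `(dᵀAd - η‖d‖²) / η`. -/
theorem isLNGMinPminus_iff_of_stationary (hA : A.IsSymm) {b ys : Fin n → ℝ} {c η : ℝ}
    (hη : 0 < η) (hst : A *ᵥ ys + b = η • ys) :
    IsLNGMinPminus A b c ys ↔ gq A b c ys = 0 ∧
      (∃ δ > 0, ∀ d : Fin n → ℝ, d ⬝ᵥ A *ᵥ d + 2 * η * (ys ⬝ᵥ d) = 0 → euclNorm d < δ →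
        η * (d ⬝ᵥ d) ≤ d ⬝ᵥ A *ᵥ d) ∧
      ∃ d : Fin n → ℝ, d ⬝ᵥ A *ᵥ d + 2 * η * (ys ⬝ᵥ d) = 0 ∧ d ⬝ᵥ A *ᵥ d < η * (d ⬝ᵥ d) := by
  have hg (d : Fin n → ℝ) :
      gq A b c (ys + d) = gq A b c ys + (d ⬝ᵥ A *ᵥ d + 2 * η * (ys ⬝ᵥ d)) := by
    have h1 : d ⬝ᵥ (A *ᵥ ys + b) = d ⬝ᵥ η • ys := by rw [hst]
    rw [dotProduct_add, dotProduct_smul, smul_eq_mul, dotProduct_comm d b,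
      dotProduct_comm d ys] at h1
    simp only [gq, mulVec_add, dotProduct_add, add_dotProduct,
      dotProduct_mulVec_comm_of_isSymm hA ys d]
    linarith
  have hobj (d : Fin n → ℝ) (hd : d ⬝ᵥ A *ᵥ d + 2 * η * (ys ⬝ᵥ d) = 0) :
      -(ys ⬝ᵥ ys) ≤ -((ys + d) ⬝ᵥ (ys + d)) ↔ η * (d ⬝ᵥ d) ≤ d ⬝ᵥ A *ᵥ d := by
    have h1 : d ⬝ᵥ A *ᵥ d - η * (d ⬝ᵥ d) =
        η * (-((ys + d) ⬝ᵥ (ys + d)) - -(ys ⬝ᵥ ys)) := by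
      simp only [dotProduct_add, add_dotProduct, dotProduct_comm d ys]
      linarith
    rw [← sub_nonneg, ← sub_nonneg (a := d ⬝ᵥ A *ᵥ d), h1, mul_nonneg_iff_of_pos_left hη]
  rw [IsLNGMinPminus, and_assoc]
  refine and_congr_right fun h0 => and_congr (exists_congr fun δ => and_congr_right fun _ => ?_) ?_
  · rw [← (Equiv.addLeft ys).forall_congr_right]
    refine forall_congr' fun d => ?_
    simp only [Equiv.coe_addLeft, hg, h0, zero_add, add_sub_cancel_left]
    exact forall_congr' fun hd => imp_congr_right fun _ => hobj d hd
  · rw [← (Equiv.addLeft ys).forall_congr_right]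
    push Not
    refine exists_congr fun d => ?_
    simp only [Equiv.coe_addLeft, hg, h0, zero_add]
    refine and_congr_right fun hd => ?_
    rw [← not_le, hobj d hd, not_le]

theorem exists_tendsto_root_of_pos (α β γ : ℝ) {p : ℝ} (hp : 0 < p) :
    ∃ σ : ℝ → ℝ, Tendsto σ (𝓝 0) (𝓝 (-α / (2 * p))) ∧
      ∀ᶠ s in 𝓝 0, α + 2 * s * σ s * β + s ^ 2 * σ s ^ 2 * γ + 2 * σ s * p = 0 := by
  have hD : ContinuousAt
      (fun s : ℝ => p + s * β + √((p + s * β) ^ 2 - γ * α * s ^ 2)) 0 := by fun_prop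
  have hD0 : p + 0 * β + √((p + 0 * β) ^ 2 - γ * α * 0 ^ 2) = 2 * p := by
    simp [Real.sqrt_sq hp.le, two_mul]
  refine ⟨fun s => -α / (p + s * β + √((p + s * β) ^ 2 - γ * α * s ^ 2)), ?_, ?_⟩
  · have := (continuousAt_const (y := -α)).div hD (by rw [hD0]; positivity)
    simpa only [ContinuousAt, Pi.div_def, hD0] using this
  · have h1 : ∀ᶠ s in 𝓝 (0 : ℝ), 0 < p + s * β + √((p + s * β) ^ 2 - γ * α * s ^ 2) :=
      hD.eventually_const_lt (by simpa only [hD0] using by positivity)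
    have h2 : ∀ᶠ s in 𝓝 (0 : ℝ), 0 < (p + s * β) ^ 2 - γ * α * s ^ 2 :=
      (show ContinuousAt (fun s : ℝ => (p + s * β) ^ 2 - γ * α * s ^ 2) 0 by
        fun_prop).eventually_const_lt (by simpa using by positivity)
    filter_upwards [h1, h2] with s hs1 hs2
    have hR := Real.sq_sqrt hs2.le
    set R := √((p + s * β) ^ 2 - γ * α * s ^ 2)
    field_simp
    linear_combination α * hR

theorem exists_tendsto_root (α β γ : ℝ) {p : ℝ} (hp : p ≠ 0) :
    ∃ σ : ℝ → ℝ, Tendsto σ (𝓝 0) (𝓝 (-α / (2 * p))) ∧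
      ∀ᶠ s in 𝓝 0, α + 2 * s * σ s * β + s ^ 2 * σ s ^ 2 * γ + 2 * σ s * p = 0 := by
  rcases hp.lt_or_gt with h | h
  · obtain ⟨σ, h1, h2⟩ := exists_tendsto_root_of_pos (-α) (-β) (-γ) (neg_pos.mpr h)
    refine ⟨σ, by rwa [mul_neg, neg_div_neg_eq] at h1, h2.mono fun s hs => by linarith⟩
  · exact exists_tendsto_root_of_pos α β γ h

/-- Along a feasible curve `s ↦ s u + s² σ(s) e` tangent to `u`, the objective does not drop below
its value at a local minimizer. -/
theorem exists_feasible_curve (hA : A.IsSymm) {y u e : Fin n → ℝ} {η : ℝ} (hη : 0 < η)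
    (hloc : ∃ δ > 0, ∀ d : Fin n → ℝ, d ⬝ᵥ A *ᵥ d + 2 * η * (y ⬝ᵥ d) = 0 → euclNorm d < δ →
        η * (d ⬝ᵥ d) ≤ d ⬝ᵥ A *ᵥ d)
    (hu : y ⬝ᵥ u = 0) (he : y ⬝ᵥ e ≠ 0) :
    ∃ σ : ℝ → ℝ, Tendsto σ (𝓝[>] 0) (𝓝 (-(u ⬝ᵥ A *ᵥ u) / (2 * (η * (y ⬝ᵥ e))))) ∧
      ∀ᶠ s in 𝓝[>] 0, 0 ≤ (u ⬝ᵥ A *ᵥ u - η * (u ⬝ᵥ u)) +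
        2 * s * σ s * (u ⬝ᵥ A *ᵥ e - η * (u ⬝ᵥ e)) +
        s ^ 2 * σ s ^ 2 * (e ⬝ᵥ A *ᵥ e - η * (e ⬝ᵥ e)) := by
  obtain ⟨δ, hδ, hloc⟩ := hloc
  obtain ⟨σ, hσ, hroot⟩ := exists_tendsto_root (u ⬝ᵥ A *ᵥ u) (u ⬝ᵥ A *ᵥ e) (e ⬝ᵥ A *ᵥ e)
    (mul_ne_zero hη.ne' he)
  refine ⟨σ, hσ.mono_left nhdsWithin_le_nhds, ?_⟩
  have hd : Tendsto (fun s => euclNorm (s • u + (s ^ 2 * σ s) • e)) (𝓝 0) (𝓝 0) := by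
    have h1 : Tendsto (fun s : ℝ => s • u + (s ^ 2 * σ s) • e) (𝓝 0) (𝓝 0) := by
      have h2 : Tendsto (fun s : ℝ => s) (𝓝 0) (𝓝 0) := tendsto_id
      simpa using (h2.smul_const u).add (((h2.pow 2).mul hσ).smul_const e)
    simpa [Function.comp_def, euclNorm_zero] using (continuous_euclNorm.tendsto 0).comp h1
  filter_upwards [nhdsWithin_le_nhds hroot, nhdsWithin_le_nhds (hd.eventually (gt_mem_nhds hδ)),
    self_mem_nhdsWithin] with s hs hsδ hs0
  have hs0 : 0 < s := hs0
  have hquad := hloc (s • u + (s ^ 2 * σ s) • e)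
  simp only [mulVec_add, mulVec_smul, dotProduct_add, add_dotProduct, dotProduct_smul,
    smul_dotProduct, smul_eq_mul, hu, dotProduct_mulVec_comm_of_isSymm hA e u,
    dotProduct_comm e u] at hquad
  have hle := hquad (by linear_combination s ^ 2 * hs) hsδ
  refine nonneg_of_mul_nonneg_right (a := s ^ 2) ?_ (by positivity)
  linarith

theorem second_order_nonneg (hA : A.IsSymm) {y u : Fin n → ℝ} {η : ℝ} (hη : 0 < η)
    (hloc : ∃ δ > 0, ∀ d : Fin n → ℝ, d ⬝ᵥ A *ᵥ d + 2 * η * (y ⬝ᵥ d) = 0 → euclNorm d < δ →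
        η * (d ⬝ᵥ d) ≤ d ⬝ᵥ A *ᵥ d)
    (hy : y ≠ 0) (hu : y ⬝ᵥ u = 0) : 0 ≤ u ⬝ᵥ A *ᵥ u - η * (u ⬝ᵥ u) := by
  obtain ⟨σ, hσ, hnn⟩ := exists_feasible_curve hA hη hloc hu
    (e := y) (by rwa [Ne, dotProduct_self_eq_zero])
  have hs : Tendsto (fun s : ℝ => s) (𝓝[>] 0) (𝓝 0) := nhdsWithin_le_nhds
  refine ge_of_tendsto ?_ hnn
  have := ((((hs.const_mul 2).mul hσ).mul_const (u ⬝ᵥ A *ᵥ y - η * (u ⬝ᵥ y))).const_add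
    (u ⬝ᵥ A *ᵥ u - η * (u ⬝ᵥ u))).add
    (((hs.pow 2).mul (hσ.pow 2)).mul_const (y ⬝ᵥ A *ᵥ y - η * (y ⬝ᵥ y)))
  simpa using this

theorem ne_zero_of_local_nonglobal {y : Fin n → ℝ} {η : ℝ}
    (hloc : ∃ δ > 0, ∀ d : Fin n → ℝ, d ⬝ᵥ A *ᵥ d + 2 * η * (y ⬝ᵥ d) = 0 → euclNorm d < δ →
        η * (d ⬝ᵥ d) ≤ d ⬝ᵥ A *ᵥ d)
    (hng : ∃ d : Fin n → ℝ, d ⬝ᵥ A *ᵥ d + 2 * η * (y ⬝ᵥ d) = 0 ∧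
      d ⬝ᵥ A *ᵥ d < η * (d ⬝ᵥ d)) : y ≠ 0 := by
  rintro rfl
  obtain ⟨δ, hδ, hloc⟩ := hloc
  obtain ⟨d, hd, hlt⟩ := hng
  have ht : Tendsto (fun t : ℝ => euclNorm (t • d)) (𝓝[>] 0) (𝓝 0) := by
    have : ContinuousAt (fun t : ℝ => euclNorm (t • d)) 0 :=
      (continuous_euclNorm.comp (by fun_prop)).continuousAt
    simpa [ContinuousAt, euclNorm_zero] using this.mono_left nhdsWithin_le_nhds
  obtain ⟨t, htδ, ht0⟩ :=
    ((ht.eventually (gt_mem_nhds hδ)).and self_mem_nhdsWithin).exists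
  have ht0 : 0 < t := ht0
  have hquad := hloc (t • d)
  simp only [zero_dotProduct, mul_zero, add_zero] at hd
  simp only [mulVec_smul, dotProduct_smul, smul_dotProduct, smul_eq_mul, zero_dotProduct, hd,
    mul_zero, add_zero] at hquad hlt
  have := hquad trivial htδ
  have : 0 < t * t * (η * (d ⬝ᵥ d)) := by positivity
  linarith

end LocalMinimizer

section Necessity

variable {n : ℕ} {A : Matrix (Fin n) (Fin n) ℝ} {lam : Fin n → ℝ} {v : Fin n → Fin n → ℝ}

theorem exists_eigenvalue_lt (hA : A.IsSymm)
    (horth : ∀ i j : Fin n, v i ⬝ᵥ v j = if i = j then (1 : ℝ) else 0)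
    (heig : ∀ i : Fin n, A *ᵥ v i = lam i • v i) {η : ℝ} {d : Fin n → ℝ}
    (hd : d ⬝ᵥ A *ᵥ d < η * (d ⬝ᵥ d)) : ∃ i, lam i < η := by
  by_contra! h
  have := sub_eq_sum_coord hA horth heig η d d
  have : 0 ≤ ∑ i, (lam i - η) * ((v i ⬝ᵥ d) * (v i ⬝ᵥ d)) :=
    sum_nonneg fun i _ => mul_nonneg (sub_nonneg.mpr (h i)) (mul_self_nonneg _)
  linarith

theorem lt_second_eigenvalue (hA : A.IsSymm)
    (horth : ∀ i j : Fin n, v i ⬝ᵥ v j = if i = j then (1 : ℝ) else 0)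
    (heig : ∀ i : Fin n, A *ᵥ v i = lam i • v i) {y : Fin n → ℝ} {η : ℝ} (hη : 0 < η)
    (hloc : ∃ δ > 0, ∀ d : Fin n → ℝ, d ⬝ᵥ A *ᵥ d + 2 * η * (y ⬝ᵥ d) = 0 → euclNorm d < δ →
        η * (d ⬝ᵥ d) ≤ d ⬝ᵥ A *ᵥ d)
    (hy : y ≠ 0) {i j : Fin n} (hij : i ≠ j) (hi : lam i < η) : η < lam j := by
  by_contra! hj
  have hpi : y ⬝ᵥ v i ≠ 0 := by
    intro h
    have := second_order_nonneg hA hη hloc hy h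
    simp only [heig, dotProduct_smul, horth, if_true, smul_eq_mul] at this
    linarith
  have hu : y ⬝ᵥ ((y ⬝ᵥ v j) • v i - (y ⬝ᵥ v i) • v j) = 0 := by
    simp only [dotProduct_sub, dotProduct_smul, smul_eq_mul]
    ring
  have h2 := second_order_nonneg hA hη hloc hy hu
  simp only [mulVec_sub, mulVec_smul, heig, dotProduct_sub, sub_dotProduct, smul_dotProduct,
    dotProduct_smul, horth, hij, hij.symm, if_true, if_false, smul_eq_mul] at h2
  have hpi2 : 0 < (y ⬝ᵥ v i) ^ 2 := by positivity
  have hpj : y ⬝ᵥ v j = 0 := by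
    by_contra h
    have : 0 < (y ⬝ᵥ v j) ^ 2 := by positivity
    nlinarith
  have hjη : lam j = η := by
    refine le_antisymm hj ?_
    rw [hpj] at h2
    nlinarith
  obtain ⟨σ, hσ, hnn⟩ := exists_feasible_curve hA hη hloc hpj hpi
  simp only [heig, dotProduct_smul, horth, hij.symm, if_true, if_false, smul_eq_mul, hjη] at hσ hnn
  have hlim : 0 ≤ (-(η * 1) / (2 * (η * (y ⬝ᵥ v i)))) ^ 2 * (lam i - η) := by
    refine ge_of_tendsto ((hσ.pow 2).mul_const (lam i - η)) ?_
    filter_upwards [hnn, self_mem_nhdsWithin] with s hs hs0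
    have hs0 : 0 < s := hs0
    refine nonneg_of_mul_nonneg_right (a := s ^ 2) ?_ (by positivity)
    linarith
  have : 0 < (-(η * 1) / (2 * (η * (y ⬝ᵥ v i)))) ^ 2 := by
    refine sq_pos_of_ne_zero (div_ne_zero ?_ ?_) <;> simp [hη.ne', hpi]
  nlinarith

theorem sum_sq_div_neg (hA : A.IsSymm)
    (horth : ∀ i j : Fin n, v i ⬝ᵥ v j = if i = j then (1 : ℝ) else 0)
    (heig : ∀ i : Fin n, A *ᵥ v i = lam i • v i) {y : Fin n → ℝ} {η : ℝ} (hη : 0 < η)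
    (hloc : ∃ δ > 0, ∀ d : Fin n → ℝ, d ⬝ᵥ A *ᵥ d + 2 * η * (y ⬝ᵥ d) = 0 → euclNorm d < δ →
        η * (d ⬝ᵥ d) ≤ d ⬝ᵥ A *ᵥ d)
    (hy : y ≠ 0) {i : Fin n} (hi : lam i < η) (hne : ∀ j, lam j - η ≠ 0) :
    ∑ j, (v j ⬝ᵥ y) ^ 2 / (lam j - η) < 0 := by
  set q := ∑ j, (v j ⬝ᵥ y) ^ 2 / (lam j - η) with hq
  obtain ⟨u, hu⟩ : ∃ u : Fin n → ℝ, ∀ j, v j ⬝ᵥ u = (v j ⬝ᵥ y) / (lam j - η) :=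
    ⟨_, coord_sum_smul horth _⟩
  have hyu : y ⬝ᵥ u = q := by
    rw [dotProduct_eq_sum_coord horth, hq]
    exact sum_congr rfl fun j _ => by rw [hu]; ring
  have hux (x : Fin n → ℝ) : u ⬝ᵥ A *ᵥ x - η * (u ⬝ᵥ x) = y ⬝ᵥ x := by
    rw [sub_eq_sum_coord hA horth heig, dotProduct_eq_sum_coord horth]
    refine sum_congr rfl fun j _ => ?_
    have := hne j
    rw [hu]
    field_simp
  by_contra! h0
  rcases h0.eq_or_lt with h0 | h0
  · rw [← h0] at hyu
    have hyy : y ⬝ᵥ y ≠ 0 := by rwa [Ne, dotProduct_self_eq_zero]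
    have hyy0 : 0 < y ⬝ᵥ y := (dotProduct_self_nonneg y).lt_of_ne' hyy
    obtain ⟨σ, hσ, hnn⟩ := exists_feasible_curve hA hη hloc hyu hyy
    have huu := hux u
    simp only [hux, hyu, zero_add] at hnn
    have hs : Tendsto (fun s : ℝ => s) (𝓝[>] 0) (𝓝 0) := nhdsWithin_le_nhds
    have hlim : 0 ≤ 2 * (-(u ⬝ᵥ A *ᵥ u) / (2 * (η * (y ⬝ᵥ y)))) * (y ⬝ᵥ y) +
        0 * (-(u ⬝ᵥ A *ᵥ u) / (2 * (η * (y ⬝ᵥ y)))) ^ 2 * (y ⬝ᵥ A *ᵥ y - η * (y ⬝ᵥ y)) := by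
      refine ge_of_tendsto (((hσ.const_mul 2).mul_const _).add
        ((hs.mul (hσ.pow 2)).mul_const _)) ?_
      filter_upwards [hnn, self_mem_nhdsWithin] with s hs hs0
      refine nonneg_of_mul_nonneg_right (a := s) ?_ hs0
      linarith
    have hu0 : 0 < u ⬝ᵥ u := by
      refine (dotProduct_self_nonneg u).lt_of_ne' fun h => hyy ?_
      rw [dotProduct_self_eq_zero] at h
      rw [← hux, h, zero_dotProduct, zero_dotProduct, mul_zero, sub_zero]
    have huAu : u ⬝ᵥ A *ᵥ u = η * (u ⬝ᵥ u) := by linarith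
    rw [huAu] at hlim
    rw [zero_mul, zero_mul, add_zero] at hlim
    have h1 : 2 * (-(η * (u ⬝ᵥ u)) / (2 * (η * (y ⬝ᵥ y)))) * (y ⬝ᵥ y) = -(u ⬝ᵥ u) := by
      field_simp
    linarith
  · have hw : y ⬝ᵥ (v i - ((v i ⬝ᵥ y) / q) • u) = 0 := by
      rw [dotProduct_sub, dotProduct_smul, hyu, smul_eq_mul, div_mul_cancel₀ _ h0.ne',
        dotProduct_comm, sub_self]
    have h2 := second_order_nonneg hA hη hloc hy hw
    have h3 := hux u
    have h4 := hux (v i)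
    rw [hyu] at h3
    simp only [mulVec_sub, mulVec_smul, dotProduct_sub, sub_dotProduct, smul_dotProduct,
      dotProduct_smul, smul_eq_mul, dotProduct_mulVec_comm_of_isSymm hA (v i) u,
      dotProduct_comm (v i) u] at h2
    rw [heig, dotProduct_smul, dotProduct_smul, horth, if_pos rfl, smul_eq_mul, smul_eq_mul] at h2
    rw [heig, dotProduct_smul, smul_eq_mul, dotProduct_comm y] at h4
    have h5 : 0 ≤ (lam i - η) - (v i ⬝ᵥ y) / q * (v i ⬝ᵥ y) := by
      have h6 : (v i ⬝ᵥ y) / q * q = v i ⬝ᵥ y := div_mul_cancel₀ _ h0.ne'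
      linear_combination h2 - 2 * ((v i ⬝ᵥ y) / q) * h4 + ((v i ⬝ᵥ y) / q) ^ 2 * h3
        + ((v i ⬝ᵥ y) / q) * h6
    have h6 : 0 ≤ (v i ⬝ᵥ y) / q * (v i ⬝ᵥ y) := by
      rw [div_mul_eq_mul_div]
      exact div_nonneg (mul_self_nonneg _) h0.le
    linarith

end Necessity

section Sufficiency

/-- A diagonal quadratic form with exactly one negative coefficient becomes nonnegative after
adding a multiple of `(wᵀz)²`, provided that `wᵀ diag(μ)⁻¹ w < 0`. -/
theorem sum_mul_sq_sub_sq_div_nonneg {ι : Type*} [Fintype ι] [DecidableEq ι] {μ w : ι → ℝ}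
    {i : ι} (hi : μ i < 0) (hpos : ∀ j ≠ i, 0 < μ j) (hq : ∑ j, w j ^ 2 / μ j < 0) (z : ι → ℝ) :
    0 ≤ ∑ j, μ j * z j ^ 2 - (∑ j, w j * z j) ^ 2 / ∑ j, w j ^ 2 / μ j := by
  have hsplit (f : ι → ℝ) : ∑ j, f j = f i + ∑ j ∈ univ.erase i, f j :=
    (add_sum_erase univ f (mem_univ i)).symm
  have hpos' : ∀ j ∈ univ.erase i, 0 < μ j := fun j hj => hpos j (ne_of_mem_erase hj)
  have hcs : (∑ j ∈ univ.erase i, w j * z j) ^ 2 ≤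
      (∑ j ∈ univ.erase i, w j ^ 2 / μ j) * ∑ j ∈ univ.erase i, μ j * z j ^ 2 := by
    refine sum_sq_le_sum_mul_sum_of_sq_le_mul _
      (fun j hj => div_nonneg (sq_nonneg _) (hpos' j hj).le)
      (fun j hj => mul_nonneg (hpos' j hj).le (sq_nonneg _)) fun j hj => Eq.le ?_
    have := (hpos' j hj).ne'
    field_simp
  have hS : 0 ≤ ∑ j ∈ univ.erase i, w j ^ 2 / μ j :=
    sum_nonneg fun j hj => div_nonneg (sq_nonneg _) (hpos' j hj).le
  have hP : 0 ≤ ∑ j ∈ univ.erase i, μ j * z j ^ 2 :=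
    sum_nonneg fun j hj => mul_nonneg (hpos' j hj).le (sq_nonneg _)
  rw [hsplit fun j => w j ^ 2 / μ j] at hq ⊢
  rw [hsplit, hsplit fun j => w j * z j]
  generalize ∑ j ∈ univ.erase i, w j ^ 2 / μ j = S at *
  generalize ∑ j ∈ univ.erase i, μ j * z j ^ 2 = P at *
  generalize ∑ j ∈ univ.erase i, w j * z j = C at *
  generalize μ i = m at *
  generalize w i = a at *
  generalize z i = x at *
  have hm : a ^ 2 / m * m = a ^ 2 := div_mul_cancel₀ _ hi.ne
  generalize a ^ 2 / m = T at *
  rw [sub_nonneg, div_le_iff_of_neg hq]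
  have hdisc : (a * C) ^ 2 ≤ (-m * S) * (-P * (T + S) + C ^ 2) := by
    nlinarith [mul_le_mul_of_nonneg_left hcs
      (mul_nonneg_of_nonpos_of_nonpos hi.le hq.le)]
  have hquad : 0 ≤ (-m * S) * x ^ 2 + 2 * (a * C) * x + (-P * (T + S) + C ^ 2) := by
    have hA0 : 0 ≤ -m * S := mul_nonneg (neg_nonneg.mpr hi.le) hS
    have hC0 : 0 ≤ -P * (T + S) + C ^ 2 := by nlinarith [sq_nonneg C]
    rcases hA0.eq_or_lt with h | h
    · rw [← h] at hdisc ⊢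
      have : a * C = 0 := by nlinarith
      rw [this]
      linarith
    · refine nonneg_of_mul_nonneg_right (a := -m * S) ?_ h
      nlinarith [sq_nonneg (-m * S * x + a * C)]
  linear_combination hquad + x ^ 2 * hm

theorem exists_pos_sum_mul_sq_add_sq_ge {ι : Type*} [Fintype ι] {μ w : ι → ℝ}
    {i : ι} (hi : μ i < 0) (hpos : ∀ j ≠ i, 0 < μ j) (hq : ∑ j, w j ^ 2 / μ j < 0) :
    ∃ m > 0, ∃ k > 0, ∀ z : ι → ℝ,
      m * ∑ j, z j ^ 2 ≤ ∑ j, μ j * z j ^ 2 + k * (∑ j, w j * z j) ^ 2 := by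
  classical
  have hne (j : ι) : μ j - 0 ≠ 0 := by
    rw [sub_zero]
    rcases eq_or_ne j i with rfl | h
    exacts [hi.ne, (hpos j h).ne']
  have hcont : ContinuousAt (fun m : ℝ => ∑ j, w j ^ 2 / (μ j - m)) 0 := by
    refine tendsto_finsetSum _ fun j _ => ?_
    exact ContinuousAt.div continuousAt_const (by fun_prop) (hne j)
  have h1 : ∀ᶠ m in 𝓝 (0 : ℝ), ∑ j, w j ^ 2 / (μ j - m) < 0 :=
    hcont.eventually (gt_mem_nhds (by simpa using hq))
  have h2 : ∀ᶠ m in 𝓝 (0 : ℝ), ∀ j, j ≠ i → 0 < μ j - m := by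
    refine eventually_all.mpr fun j => ?_
    by_cases hj : j = i
    · simp [hj]
    · filter_upwards [gt_mem_nhds (hpos j hj)] with m hm _ using sub_pos.mpr hm
  obtain ⟨m, ⟨h1, h2⟩, hm⟩ := (((h1.and h2).filter_mono
    (nhdsWithin_le_nhds (s := Set.Ioi 0))).and self_mem_nhdsWithin).exists
  have hm : 0 < m := hm
  refine ⟨m, hm, -(∑ j, w j ^ 2 / (μ j - m))⁻¹, neg_pos.mpr (inv_lt_zero.mpr h1), fun z => ?_⟩
  have h3 := sum_mul_sq_sub_sq_div_nonneg (μ := fun j => μ j - m) (by linarith) h2 h1 z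
  simp only [sub_mul, sum_sub_distrib, ← mul_sum, div_eq_mul_inv _ (∑ j, w j ^ 2 / (μ j - m))]
    at h3
  linarith

variable {n : ℕ} {A : Matrix (Fin n) (Fin n) ℝ} {lam : Fin n → ℝ} {v : Fin n → Fin n → ℝ}

theorem local_min_of_sum_sq_div_neg (hA : A.IsSymm)
    (horth : ∀ i j : Fin n, v i ⬝ᵥ v j = if i = j then (1 : ℝ) else 0)
    (heig : ∀ i : Fin n, A *ᵥ v i = lam i • v i) {y : Fin n → ℝ} {η : ℝ} (hη : 0 < η)
    {i : Fin n} (hi : lam i < η) (hpos : ∀ j ≠ i, η < lam j)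
    (hq : ∑ j, (v j ⬝ᵥ y) ^ 2 / (lam j - η) < 0) :
    ∃ δ > 0, ∀ d : Fin n → ℝ, d ⬝ᵥ A *ᵥ d + 2 * η * (y ⬝ᵥ d) = 0 → euclNorm d < δ →
        η * (d ⬝ᵥ d) ≤ d ⬝ᵥ A *ᵥ d := by
  obtain ⟨m, hm, k, hk, hcoer⟩ := exists_pos_sum_mul_sq_add_sq_ge (μ := fun j => lam j - η)
    (sub_neg.mpr hi) (fun j hj => sub_pos.mpr (hpos j hj)) hq
  set C := (η - lam i) / η + 1 with hC
  have hC0 : 0 < C := by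
    have : 0 < η - lam i := sub_pos.mpr hi
    positivity
  refine ⟨√(m / (k * C ^ 2)), by positivity, fun d hd hdδ => ?_⟩
  have hdd : (d ⬝ᵥ d) < m / (k * C ^ 2) := by
    rw [← euclNorm_sq]
    exact (Real.lt_sqrt (Real.sqrt_nonneg _)).mp hdδ
  rw [lt_div_iff₀ (by positivity)] at hdd
  have hd0 : 0 ≤ d ⬝ᵥ d := dotProduct_self_nonneg d
  have hQ := sub_eq_sum_coord hA horth heig η d d
  have hco := hcoer fun j => v j ⬝ᵥ d
  have hnorm := dotProduct_eq_sum_coord horth d d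
  have hlow : -(η - lam i) * (d ⬝ᵥ d) ≤ d ⬝ᵥ A *ᵥ d - η * (d ⬝ᵥ d) := by
    rw [hQ, hnorm, mul_sum]
    refine sum_le_sum fun j _ => mul_le_mul_of_nonneg_right ?_ (mul_self_nonneg _)
    rcases eq_or_ne j i with rfl | h
    · linarith
    · linarith [hpos j h]
  rw [← dotProduct_eq_sum_coord horth y d] at hco
  simp only [← pow_two] at hQ hnorm
  rw [← hQ, ← hnorm] at hco
  by_contra! hneg
  have hyd1 : 2 * (y ⬝ᵥ d) ≤ C * (d ⬝ᵥ d) := by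
    have : η * (2 * (y ⬝ᵥ d)) ≤ η * (C * (d ⬝ᵥ d)) := by
      have : η * (C * (d ⬝ᵥ d)) = (η - lam i + η) * (d ⬝ᵥ d) := by rw [hC]; field_simp
      nlinarith
    exact le_of_mul_le_mul_left this hη
  have hyd2 : -(C * (d ⬝ᵥ d)) ≤ 2 * (y ⬝ᵥ d) := by
    have hC1 : 1 ≤ C := by
      have : 0 < (η - lam i) / η := div_pos (sub_pos.mpr hi) hη
      linarith
    have : -(d ⬝ᵥ d) ≤ 2 * (y ⬝ᵥ d) := by nlinarith
    nlinarith
  have hsq : (2 * (y ⬝ᵥ d)) ^ 2 ≤ (C * (d ⬝ᵥ d)) ^ 2 := sq_le_sq' hyd2 hyd1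
  have h1 : k * (2 * (y ⬝ᵥ d)) ^ 2 ≤ k * (C * (d ⬝ᵥ d)) ^ 2 := mul_le_mul_of_nonneg_left hsq hk.le
  have h2 : d ⬝ᵥ d * (d ⬝ᵥ d * (k * C ^ 2)) ≤ d ⬝ᵥ d * m := mul_le_mul_of_nonneg_left hdd.le hd0
  have h3 : 0 ≤ m * (d ⬝ᵥ d) := by positivity
  linarith

theorem exists_feasible_descent
    (horth : ∀ i j : Fin n, v i ⬝ᵥ v j = if i = j then (1 : ℝ) else 0)
    (heig : ∀ i : Fin n, A *ᵥ v i = lam i • v i) {y : Fin n → ℝ} {η : ℝ} (hη : 0 < η)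
    {i j : Fin n} (hij : i ≠ j) (hi : lam i < η) (hj : η < lam j) (hyi : y ⬝ᵥ v i ≠ 0) :
    ∃ d : Fin n → ℝ, d ⬝ᵥ A *ᵥ d + 2 * η * (y ⬝ᵥ d) = 0 ∧ d ⬝ᵥ A *ᵥ d < η * (d ⬝ᵥ d) := by
  have h1 : ∀ᶠ ε in 𝓝 (0 : ℝ), y ⬝ᵥ v i + ε * (y ⬝ᵥ v j) ≠ 0 :=
    (show ContinuousAt (fun ε : ℝ => y ⬝ᵥ v i + ε * (y ⬝ᵥ v j)) 0 by fun_prop).eventually_ne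
      (by simpa using hyi)
  have h2 : ∀ᶠ ε in 𝓝 (0 : ℝ), (lam i - η) + ε ^ 2 * (lam j - η) < 0 :=
    (show ContinuousAt (fun ε : ℝ => (lam i - η) + ε ^ 2 * (lam j - η)) 0 by
      fun_prop).eventually_lt_const (by simpa using hi)
  have h3 : ∀ᶠ ε in 𝓝[>] (0 : ℝ), lam i + ε ^ 2 * lam j ≠ 0 := by
    have hjpos : 0 < lam j := hη.trans hj
    by_cases h0 : lam i = 0
    · filter_upwards [self_mem_nhdsWithin] with ε hε
      have hε : 0 < ε := hε
      rw [h0, zero_add]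
      positivity
    · exact nhdsWithin_le_nhds ((show ContinuousAt (fun ε : ℝ => lam i + ε ^ 2 * lam j) 0 by
        fun_prop).eventually_ne (by simpa using h0))
  obtain ⟨ε, ⟨h1, h2⟩, h3⟩ := (((h1.and h2).filter_mono nhdsWithin_le_nhds).and h3).exists
  set t := -(2 * η * (y ⬝ᵥ v i + ε * (y ⬝ᵥ v j))) / (lam i + ε ^ 2 * lam j) with ht
  have ht0 : t ≠ 0 :=
    div_ne_zero (neg_ne_zero.mpr (mul_ne_zero (by positivity) h1)) h3
  have ht' : t * (lam i + ε ^ 2 * lam j) = -(2 * η * (y ⬝ᵥ v i + ε * (y ⬝ᵥ v j))) :=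
    div_mul_cancel₀ _ h3
  have ht2 : 0 < t ^ 2 := by positivity
  refine ⟨t • (v i + ε • v j), ?_, ?_⟩ <;>
    simp only [mulVec_add, mulVec_smul, heig, dotProduct_add, add_dotProduct, smul_dotProduct,
      dotProduct_smul, horth, hij, hij.symm, if_true, if_false, smul_eq_mul]
  · linear_combination t * ht'
  · nlinarith [mul_neg_of_pos_of_neg ht2 h2]

end Sufficiency

theorem stmt16 {n : ℕ} (hn : 2 ≤ n)
    (A : Matrix (Fin n) (Fin n) ℝ) (hA : A.IsSymm)
    (b : Fin n → ℝ) (c : ℝ)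
    (lam : Fin n → ℝ) (hmono : Monotone lam)
    (v : Fin n → Fin n → ℝ)
    (horth : ∀ i j : Fin n, v i ⬝ᵥ v j = if i = j then (1:ℝ) else 0)
    (heig : ∀ i : Fin n, A.mulVec (v i) = lam i • v i)
    (ys : Fin n → ℝ) (ηs : ℝ) (hηs : 0 < ηs) :
    (IsLNGMinPminus A b c ys ∧
      (-(1 : Matrix (Fin n) (Fin n) ℝ) + (1 / ηs) • A).mulVec ys + (1 / ηs) • b = 0) ↔
    (max (lam ⟨0, by omega⟩) 0 < ηs ∧ ηs < lam ⟨1, by omega⟩ ∧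
      v ⟨0, by omega⟩ ⬝ᵥ b ≠ 0 ∧
      ys = yThree lam v b ηs ∧
      psiThree lam v b c ηs = 0 ∧
      psiThree' lam v b ηs < 0) := by
  set i0 : Fin n := ⟨0, by omega⟩ with hi0
  set i1 : Fin n := ⟨1, by omega⟩ with hi1
  have h01 : i0 ≠ i1 := by simp [hi0, hi1]
  have hle0 (j : Fin n) : lam i0 ≤ lam j := hmono (Nat.zero_le _)
  have hle1 (j : Fin n) (hj : j ≠ i0) : lam i1 ≤ lam j :=
    hmono (Nat.one_le_iff_ne_zero.mpr fun h => hj (Fin.ext h))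
  have hne (h0 : lam i0 < ηs) (h1 : ηs < lam i1) (j : Fin n) : lam j - ηs ≠ 0 := by
    rcases eq_or_ne j i0 with rfl | h
    · exact (sub_neg.mpr h0).ne
    · exact (sub_pos.mpr (h1.trans_le (hle1 j h))).ne'
  rw [stationary_iff hηs, max_lt_iff]
  constructor
  · rintro ⟨hmin, hst⟩
    obtain ⟨hfeas, hloc, hng⟩ := (isLNGMinPminus_iff_of_stationary hA hηs hst).mp hmin
    have hy0 : ys ≠ 0 := ne_zero_of_local_nonglobal hloc hng
    have hlt0 : lam i0 < ηs := by
      obtain ⟨d, -, hd⟩ := hng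
      obtain ⟨j, hj⟩ := exists_eigenvalue_lt hA horth heig hd
      exact (hle0 j).trans_lt hj
    have hlt1 : ηs < lam i1 := lt_second_eigenvalue hA horth heig hηs hloc hy0 h01 hlt0
    have hne := hne hlt0 hlt1
    have hys := (stationary_iff_eq_yThree hA horth heig hne).mp hst
    have hq := sum_sq_div_neg hA horth heig hηs hloc hy0 hlt0 hne
    refine ⟨⟨hlt0, hηs⟩, hlt1, fun hr => ?_, hys, ?_,
      (psiThree'_neg_iff horth hηs hne hys).mpr hq⟩
    · refine hq.not_ge (sum_nonneg fun j _ => ?_)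
      rcases eq_or_ne j i0 with rfl | h
      · rw [hys, coord_yThree horth, hr]
        simp
      · exact div_nonneg (sq_nonneg _) (sub_nonneg.mpr (hlt1.le.trans (hle1 j h)))
    · rw [← gq_yThree hA horth heig, ← hys, hfeas]
  · rintro ⟨⟨hlt0, -⟩, hlt1, hr, hys, hpsi, hpsi'⟩
    have hne := hne hlt0 hlt1
    have hst := (stationary_iff_eq_yThree hA horth heig hne).mpr hys
    have hq := (psiThree'_neg_iff horth hηs hne hys).mp hpsi'
    refine ⟨(isLNGMinPminus_iff_of_stationary hA hηs hst).mpr ⟨?_, ?_, ?_⟩, hst⟩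
    · rw [hys, gq_yThree hA horth heig, hpsi]
    · exact local_min_of_sum_sq_div_neg hA horth heig hηs hlt0
        (fun j hj => hlt1.trans_le (hle1 j hj)) hq
    · refine exists_feasible_descent horth heig hηs h01 hlt0 hlt1 ?_
      rw [dotProduct_comm, hys, coord_yThree horth]
      exact neg_ne_zero.mpr (div_ne_zero hr (hne i0))
end

section
/- Suppose A₀ and A₁ are jointly negative definite, i.e., there exists μ₁ ∈ ℝ such that A₀ + μ₁A₁ is negative definite. Then the problem (GTRE) has at most one local-nonglobal minimizer. -/
open Matrix Finset

section QuadricCriticalPoints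

variable {V : Type*} [AddCommGroup V] [Module ℝ V]

/-- The inhomogeneous quadratic function with quadratic part `A`, linear part `2ℓ`, constant `c`. -/
def quadFun (A : V →ₗ[ℝ] V →ₗ[ℝ] ℝ) (ℓ : V →ₗ[ℝ] ℝ) (c : ℝ) (w : V) : ℝ :=
  A w w + 2 * ℓ w + c

/-- `x` maximizes `P w w` over `q = 0`, locally within every plane through `x`. -/
def IsPlanarLocalMax (P : V →ₗ[ℝ] V →ₗ[ℝ] ℝ) (q : V → ℝ) (x : V) : Prop :=
  ∀ v e : V, ∃ δ > (0 : ℝ), ∀ t s : ℝ, |t| < δ → |s| < δ → q (x + t • v + s • e) = 0 →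
    P (x + t • v + s • e) (x + t • v + s • e) ≤ P x x

variable {P A : V →ₗ[ℝ] V →ₗ[ℝ] ℝ} {ℓ : V →ₗ[ℝ] ℝ} {c : ℝ} {x y z : V}

theorem quadFun_add (hA : ∀ u v, A u v = A v u) (x u : V) :
    quadFun A ℓ c (x + u) = quadFun A ℓ c x + 2 * (A x u + ℓ u) + A u u := by
  simp only [quadFun, map_add, LinearMap.add_apply]
  linear_combination hA u x

/-- A quadratic equation close to `2 s + t² a = 0` has a root close to `-t² a / 2`. -/
theorem exists_root_near (a h k ε : ℝ) (hε : 0 < ε) :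
    ∃ δ > (0 : ℝ), ∀ t : ℝ, |t| < δ →
      ∃ s : ℝ, 2 * s + t ^ 2 * a + 2 * t * s * h + s ^ 2 * k = 0 ∧
        |s + t ^ 2 * a / 2| ≤ ε * t ^ 2 := by
  set C : ℝ := |a| / 2 + ε with hC
  have hC0 : 0 < C := by positivity
  set D : ℝ := 2 * C * |h| + C ^ 2 * |k| + 1 with hD
  have hD0 : 0 < D := by positivity
  refine ⟨min 1 (2 * ε / D), by positivity, fun t ht => ?_⟩
  have ht1 : |t| < 1 := lt_of_lt_of_le ht (min_le_left _ _)
  have ht2 : |t| * D ≤ 2 * ε := by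
    have := lt_of_lt_of_le ht (min_le_right _ _)
    rw [lt_div_iff₀ hD0] at this
    exact this.le
  have hT : |t| ^ 2 = t ^ 2 := sq_abs t
  have ht0 : 0 ≤ |t| := abs_nonneg t
  have err : ∀ s : ℝ, |s| ≤ C * t ^ 2 → |2 * t * s * h + s ^ 2 * k| ≤ 2 * ε * t ^ 2 := by
    intro s hs
    have h1 : |2 * t * s * h| ≤ 2 * |t| * (C * t ^ 2) * |h| := by
      rw [abs_mul, abs_mul, abs_mul, abs_two]
      gcongr
    have h2 : |s ^ 2 * k| ≤ (C * t ^ 2) ^ 2 * |k| := by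
      rw [abs_mul, abs_pow]
      gcongr
    have h3 : (C * t ^ 2) ^ 2 * |k| ≤ C ^ 2 * |k| * |t| * t ^ 2 := by
      have : t ^ 2 ≤ |t| := by rw [← hT]; nlinarith
      have h4 : (C ^ 2 * |k| * t ^ 2) * t ^ 2 ≤ (C ^ 2 * |k| * t ^ 2) * |t| :=
        mul_le_mul_of_nonneg_left this (by positivity)
      linarith
    calc |2 * t * s * h + s ^ 2 * k| ≤ |2 * t * s * h| + |s ^ 2 * k| := abs_add_le _ _
      _ ≤ 2 * |t| * (C * t ^ 2) * |h| + C ^ 2 * |k| * |t| * t ^ 2 := by linarith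
      _ ≤ (|t| * D) * t ^ 2 := by
        have : 0 ≤ |t| * t ^ 2 := by positivity
        rw [hD]; linarith
      _ ≤ 2 * ε * t ^ 2 := by gcongr
  have hat : |t ^ 2 * a / 2| = |a| / 2 * t ^ 2 := by
    rw [abs_div, abs_mul, abs_two, abs_of_nonneg (sq_nonneg t)]; ring
  have hcont : ContinuousOn (fun s : ℝ => 2 * s + t ^ 2 * a + 2 * t * s * h + s ^ 2 * k)
      (Set.Icc (-(t ^ 2 * a / 2) - ε * t ^ 2) (-(t ^ 2 * a / 2) + ε * t ^ 2)) := by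
    fun_prop
  have hεt : 0 ≤ ε * t ^ 2 := by positivity
  have hab := abs_le.1 hat.le
  have e1 := abs_le.1 (err (-(t ^ 2 * a / 2) - ε * t ^ 2)
    (abs_le.2 ⟨by rw [hC]; linarith, by rw [hC]; linarith⟩))
  have e2 := abs_le.1 (err (-(t ^ 2 * a / 2) + ε * t ^ 2)
    (abs_le.2 ⟨by rw [hC]; linarith, by rw [hC]; linarith⟩))
  obtain ⟨s, hs, hs0⟩ := intermediate_value_Icc (by linarith) hcont
    (show (0 : ℝ) ∈ Set.Icc _ _ from ⟨by linarith, by linarith⟩)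
  exact ⟨s, hs0, abs_le.2 ⟨by linarith [hs.1], by linarith [hs.2]⟩⟩

/-- The quadric contains no line through a planar local maximizer of a positive definite form. -/
theorem IsPlanarLocalMax.not_line (hP : ∀ v, v ≠ 0 → 0 < P v v) (hPs : ∀ u v, P u v = P v u)
    {q : V → ℝ} (h : IsPlanarLocalMax P q x) {v : V} (hv : v ≠ 0) :
    ¬ ∀ t : ℝ, q (x + t • v) = 0 := by
  intro hq
  obtain ⟨δ, hδ, H⟩ := h v 0
  have key : ∀ t : ℝ, |t| < δ → 2 * t * P x v + t ^ 2 * P v v ≤ 0 := by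
    intro t ht
    have := H t 0 ht (by simpa using hδ) (by simpa using hq t)
    simp only [smul_zero, add_zero, map_add, map_smul, LinearMap.add_apply, LinearMap.smul_apply,
      smul_eq_mul] at this
    rw [hPs v x] at this
    linarith
  have h1 := key (δ / 2) (by rw [abs_of_pos] <;> linarith)
  have h2 := key (-(δ / 2)) (by rw [abs_neg, abs_of_pos] <;> linarith)
  have : 0 < (δ / 2) ^ 2 * P v v := mul_pos (by positivity) (hP v hv)
  linarith

/-- A singular point of the quadric that is a local maximizer is the only point of the quadric. -/
theorem IsPlanarLocalMax.eq_of_gradient_eq_zero (hP : ∀ v, v ≠ 0 → 0 < P v v)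
    (hPs : ∀ u v, P u v = P v u) (hA : ∀ u v, A u v = A v u)
    (h : IsPlanarLocalMax P (quadFun A ℓ c) x) (hx : quadFun A ℓ c x = 0)
    (hg : ∀ v, A x v + ℓ v = 0) (hz : quadFun A ℓ c z = 0) : z = x := by
  by_contra hne
  refine h.not_line hP hPs (sub_ne_zero.2 hne) fun t => ?_
  have h1 := quadFun_add (ℓ := ℓ) (c := c) hA x (z - x)
  rw [add_sub_cancel, hz, hx, hg] at h1
  rw [quadFun_add hA, hx, hg]
  simp only [map_smul, LinearMap.smul_apply, smul_eq_mul]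
  rw [show A (z - x) (z - x) = 0 by linarith]
  ring

theorem eq_zero_of_linear_le_sq {p K δ : ℝ} (hδ : 0 < δ)
    (H : ∀ t : ℝ, |t| < δ → t * p ≤ K * t ^ 2) : p = 0 := by
  have hK : 0 < |K| + 1 := by positivity
  have key : ∀ p : ℝ, (∀ t : ℝ, |t| < δ → t * p ≤ K * t ^ 2) → p ≤ 0 := by
    intro p H
    by_contra! hp
    set t := min (δ / 2) (p / (|K| + 1) / 2) with ht
    have ht0 : 0 < t := by positivity
    have h1 : t ≤ δ / 2 := min_le_left _ _
    have h2 : t ≤ p / (|K| + 1) / 2 := min_le_right _ _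
    have h3 : t * (|K| + 1) ≤ p / 2 := by
      calc t * (|K| + 1) ≤ p / (|K| + 1) / 2 * (|K| + 1) := by gcongr
        _ = p / 2 := by field_simp
    have h4 := H t (by rw [abs_of_pos ht0]; linarith)
    have h5 : p ≤ K * t := by
      by_contra! h
      nlinarith
    nlinarith [le_abs_self K]
  have h1 := key p H
  have h2 := key (-p) (fun t ht => by
    have := H (-t) (by rwa [abs_neg])
    linarith [this, neg_sq t, show K * (-t) ^ 2 = K * t ^ 2 by ring])
  linarith

theorem nonpos_of_sq_le_cube {p K δ : ℝ} (hδ : 0 < δ)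
    (H : ∀ t : ℝ, 0 < t → t < δ → t ^ 2 * p ≤ K * t ^ 3) : p ≤ 0 := by
  by_contra! hp
  set t := min (δ / 2) (p / (|K| + 1) / 2) with ht
  have hK : 0 < |K| + 1 := by positivity
  have ht0 : 0 < t := by positivity
  have h1 : t ≤ δ / 2 := min_le_left _ _
  have h2 : t ≤ p / (|K| + 1) / 2 := min_le_right _ _
  have h3 : t * (|K| + 1) ≤ p / 2 := by
    calc t * (|K| + 1) ≤ p / (|K| + 1) / 2 * (|K| + 1) := by gcongr
      _ = p / 2 := by field_simp
  have h4 := H t ht0 (by linarith)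
  have h5 : p ≤ K * t := by
    by_contra! h
    nlinarith [pow_pos ht0 2]
  nlinarith [le_abs_self K]

/-- First and second order necessary conditions at a regular point. -/
theorem IsPlanarLocalMax.exists_multiplier (hPs : ∀ u v, P u v = P v u)
    (hA : ∀ u v, A u v = A v u)
    (h : IsPlanarLocalMax P (quadFun A ℓ c) x) (hx : quadFun A ℓ c x = 0)
    {e : V} (he : A x e + ℓ e = 1) :
    (∀ v, P x v = P x e * (A x v + ℓ v)) ∧
      ∀ v, A x v + ℓ v = 0 → P v v ≤ P x e * A v v := by
  -- the values of `P` along a curve in the quadric tangent to `v`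
  have curve : ∀ v, A x v + ℓ v = 0 → ∀ ε > (0 : ℝ), ∃ δ > (0 : ℝ), δ ≤ 1 ∧ ∀ t : ℝ, |t| < δ →
      ∃ s : ℝ, |s + t ^ 2 * A v v / 2| ≤ ε * t ^ 2 ∧
        2 * t * P x v + 2 * s * P x e + t ^ 2 * P v v + 2 * t * s * P v e + s ^ 2 * P e e ≤ 0 := by
    intro v hv ε hε
    obtain ⟨δ₁, hδ₁, H₁⟩ := h v e
    obtain ⟨δ₂, hδ₂, H₂⟩ := exists_root_near (A v v) (A v e) (A e e) ε hε
    have hC0 : 0 < |A v v| / 2 + ε := by positivity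
    refine ⟨min (min δ₂ 1) (min δ₁ (δ₁ / (|A v v| / 2 + ε))), by positivity,
      (min_le_left _ _).trans (min_le_right _ _), fun t ht => ?_⟩
    simp only [lt_min_iff] at ht
    obtain ⟨⟨ht2, ht1⟩, ht3, ht4⟩ := ht
    obtain ⟨s, hs0, hs⟩ := H₂ t ht2
    refine ⟨s, hs, ?_⟩
    have hsC : |s| < δ₁ := by
      rw [lt_div_iff₀ hC0] at ht4
      have hT : |t| ^ 2 = t ^ 2 := sq_abs t
      have h1 : t ^ 2 ≤ |t| := by rw [← hT]; nlinarith [abs_nonneg t]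
      have h2 : |s| ≤ |s + t ^ 2 * A v v / 2| + |t ^ 2 * A v v / 2| := by
        have := abs_sub (s + t ^ 2 * A v v / 2) (t ^ 2 * A v v / 2)
        rwa [show s + t ^ 2 * A v v / 2 - t ^ 2 * A v v / 2 = s by ring] at this
      have hat : |t ^ 2 * A v v / 2| = |A v v| / 2 * t ^ 2 := by
        rw [abs_div, abs_mul, abs_two, abs_of_nonneg (sq_nonneg t)]; ring
      have h3 : (|A v v| / 2 + ε) * t ^ 2 ≤ (|A v v| / 2 + ε) * |t| := by gcongr
      linarith
    have hq : quadFun A ℓ c (x + t • v + s • e) = 0 := by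
      rw [add_assoc, quadFun_add hA, hx]
      simp only [map_add, map_smul, LinearMap.add_apply, LinearMap.smul_apply, smul_eq_mul]
      rw [hA e v]
      linear_combination hs0 + 2 * t * hv + 2 * s * he
    have := H₁ t s ht3 hsC hq
    simp only [map_add, map_smul, LinearMap.add_apply, LinearMap.smul_apply, smul_eq_mul] at this
    rw [hPs v x, hPs e x, hPs e v] at this
    linarith
  -- the same with the remainder bounded
  have bound : ∀ v, A x v + ℓ v = 0 → ∀ ε > (0 : ℝ), ∃ δ > (0 : ℝ), ∃ K : ℝ, ∀ t : ℝ, |t| < δ →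
        2 * t * P x v + t ^ 2 * (P v v - A v v * P x e - 2 * ε * |P x e|) ≤ K * |t| ^ 3 := by
    intro v hv ε hε
    obtain ⟨δ, hδ, hδ1, H⟩ := curve v hv ε hε
    set C : ℝ := |A v v| / 2 + ε with hC
    refine ⟨δ, hδ, 2 * C * |P v e| + C ^ 2 * |P e e|, fun t ht => ?_⟩
    obtain ⟨s, hs, hle⟩ := H t ht
    have hC0 : 0 < C := by positivity
    have hT : |t| ^ 2 = t ^ 2 := sq_abs t
    have h2 : |s| ≤ |s + t ^ 2 * A v v / 2| + |t ^ 2 * A v v / 2| := by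
      have := abs_sub (s + t ^ 2 * A v v / 2) (t ^ 2 * A v v / 2)
      rwa [show s + t ^ 2 * A v v / 2 - t ^ 2 * A v v / 2 = s by ring] at this
    have hat : |t ^ 2 * A v v / 2| = |A v v| / 2 * t ^ 2 := by
      rw [abs_div, abs_mul, abs_two, abs_of_nonneg (sq_nonneg t)]; ring
    have hsC : |s| ≤ C * |t| ^ 2 := by rw [hT, hC]; linarith
    have b1 : |2 * t * s * P v e| ≤ 2 * |t| * (C * |t| ^ 2) * |P v e| := by
      rw [abs_mul, abs_mul, abs_mul, abs_two]
      gcongr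
    have b2 : |s ^ 2 * P e e| ≤ (C * |t| ^ 2) ^ 2 * |P e e| := by
      rw [abs_mul, abs_pow]
      gcongr
    have b3 : (C * |t| ^ 2) ^ 2 * |P e e| ≤ C ^ 2 * |P e e| * |t| ^ 3 := by
      have h4 : (C ^ 2 * |P e e| * |t| ^ 3) * |t| ≤ (C ^ 2 * |P e e| * |t| ^ 3) * 1 :=
        mul_le_mul_of_nonneg_left (by linarith) (by positivity)
      linarith
    have b4 : |(s + t ^ 2 * A v v / 2) * P x e| ≤ ε * t ^ 2 * |P x e| := by
      rw [abs_mul]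
      gcongr
    have c1 := abs_le.1 b1
    have c2 := abs_le.1 b2
    have c4 := abs_le.1 b4
    linarith
  have tangent : ∀ v, A x v + ℓ v = 0 → P x v = 0 := by
    intro v hv
    obtain ⟨δ, hδ, K, H⟩ := bound v hv 1 one_pos
    refine eq_zero_of_linear_le_sq (δ := min δ 1)
      (K := (|K| - (P v v - A v v * P x e - 2 * 1 * |P x e|)) / 2) (by positivity)
      fun t ht => ?_
    have h1 := H t (ht.trans_le (min_le_left _ _))
    have ht1 : |t| < 1 := ht.trans_le (min_le_right _ _)
    have h2 : K * |t| ^ 3 ≤ |K| * t ^ 2 := by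
      have hT : |t| ^ 2 = t ^ 2 := sq_abs t
      have h3 : |t| ^ 3 ≤ t ^ 2 := by
        rw [← hT]; nlinarith [abs_nonneg t, pow_nonneg (abs_nonneg t) 2]
      calc K * |t| ^ 3 ≤ |K| * |t| ^ 3 := by gcongr; exact le_abs_self K
        _ ≤ |K| * t ^ 2 := by gcongr
    linarith
  refine ⟨fun v => ?_, fun v hv => ?_⟩
  · have := tangent (v - (A x v + ℓ v) • e) (by
      simp only [map_sub, map_smul, smul_eq_mul]
      linear_combination -(A x v + ℓ v) * he)
    simp only [map_sub, map_smul, smul_eq_mul] at this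
    linarith
  · refine le_of_forall_pos_le_add fun η hη => ?_
    have hX : 0 < 2 * |P x e| + 1 := by positivity
    obtain ⟨δ, hδ, K, H⟩ := bound v hv (η / (2 * |P x e| + 1)) (by positivity)
    have h1 := nonpos_of_sq_le_cube hδ (K := K)
      (p := P v v - A v v * P x e - 2 * (η / (2 * |P x e| + 1)) * |P x e|) (fun t ht0 ht => by
        have := H t (by rwa [abs_of_pos ht0])
        rw [tangent v hv, abs_of_pos ht0] at this
        linarith)
    have h2 : 2 * (η / (2 * |P x e| + 1)) * |P x e| ≤ η := by
      rw [show 2 * (η / (2 * |P x e| + 1)) * |P x e| = η * (2 * |P x e|) / (2 * |P x e| + 1) by ring,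
        div_le_iff₀ hX]
      nlinarith
    linarith

/-- Two local maximizers with positive multipliers, the better of which is not global, coincide. -/
theorem eq_of_multipliers_pos (hP : ∀ v, v ≠ 0 → 0 < P v v) (hPs : ∀ u v, P u v = P v u)
    (hA : ∀ u v, A u v = A v u) {α β : ℝ} (hα : 0 < α) (hβ : 0 < β)
    (hx : quadFun A ℓ c x = 0) (hy : quadFun A ℓ c y = 0) (hz : quadFun A ℓ c z = 0)
    (hgx : ∀ v, A x v + ℓ v = α * P x v) (hgy : ∀ v, A y v + ℓ v = β * P y v)
    (hy2 : ∀ v, P y v = 0 → β * P v v ≤ A v v)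
    (hle : P y y ≤ P x x) (hlt : P x x < P z z) : x = y := by
  by_contra hne
  obtain ⟨d, rfl⟩ : ∃ d, y = x + d := ⟨y - x, by abel⟩
  obtain ⟨u, rfl⟩ : ∃ u, z = x + u := ⟨z - x, by abel⟩
  have hd : d ≠ 0 := by rintro rfl; simp at hne
  have hdd := hP d hd
  have hPn : ∀ v, 0 ≤ P v v := fun v => by
    by_cases hv : v = 0
    · simp [hv]
    · exact (hP v hv).le
  rw [quadFun_add hA, hx, hgx] at hy hz
  have hMd : ∀ v, A d v - α * P d v = (β - α) * P (x + d) v := fun v => by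
    have h1 := hgx v
    have h2 := hgy v
    simp only [map_add, LinearMap.add_apply] at h2 ⊢
    linear_combination h2 - h1
  simp only [map_add, LinearMap.add_apply] at hle hlt
  rw [hPs d x] at hle
  rw [hPs u x] at hlt
  have hMdd := hMd d
  have hyd : P (x + d) d = P x d + P d d := by simp
  rw [hyd] at hMdd
  have hD : α * (-(2 * P x d + P d d)) = (β - α) * (P x d + P d d) := by
    linear_combination hMdd - hy
  have hτ : (β - α) * P d d = (α + β) * (-(2 * P x d + P d d)) := by
    linear_combination -2 * hD
  have hτ0 : 0 ≤ β - α := by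
    have : 0 ≤ (β - α) * P d d := hτ ▸ mul_nonneg (by linarith) (by linarith)
    exact nonneg_of_mul_nonneg_left this hdd
  have hpos : 0 < P (x + d) d := by
    rw [hyd]
    rcases hτ0.eq_or_lt with h0 | h0
    · rw [← h0, zero_mul, eq_comm, mul_eq_zero] at hτ
      rcases hτ with h | h <;> linarith
    · have h1 : 0 < (α + β) * (-(2 * P x d + P d d)) := hτ ▸ mul_pos h0 hdd
      have h2 : 0 < (β - α) * (P x d + P d d) :=
        hD ▸ mul_pos hα (pos_of_mul_pos_right h1 (by linarith))
      exact pos_of_mul_pos_right h2 hτ0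
  obtain ⟨s, v, rfl, hv⟩ : ∃ (s : ℝ) (v : V), u = s • d + v ∧ P (x + d) v = 0 := by
    refine ⟨P (x + d) u / P (x + d) d, u - (P (x + d) u / P (x + d) d) • d, by abel, ?_⟩
    rw [map_sub, map_smul, smul_eq_mul, div_mul_cancel₀ _ hpos.ne', sub_self]
  have hvv := hy2 v hv
  have hMv := hMd v
  rw [hv, mul_zero] at hMv
  simp only [map_add, map_smul, LinearMap.add_apply, LinearMap.smul_apply, smul_eq_mul] at hz hlt
  rw [hA v d] at hz
  rw [hPs v d] at hlt
  have h1 : 0 ≤ s ^ 2 * ((β - α) * P (x + d) d) := by positivity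
  have h2 : 0 ≤ (β - α) * P v v := mul_nonneg hτ0 (hPn v)
  rw [← hMd d] at h1
  have h3 := mul_lt_mul_of_pos_left hlt hα
  refine lt_irrefl (0 : ℝ) ?_
  linear_combination h1 + h2 + h3 + hvv + hz - 2 * s * hMv

theorem nonneg_of_multipliers_opposite (hP : ∀ v, v ≠ 0 → 0 < P v v)
    (hPs : ∀ u v, P u v = P v u)
    (hA : ∀ u v, A u v = A v u) {α β : ℝ} (hβα : β < α)
    (hgx : ∀ v, A x v + ℓ v = α * P x v) (hgy : ∀ v, A y v + ℓ v = β * P y v)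
    (hx2 : ∀ v, P x v = 0 → α * P v v ≤ A v v) (hy2 : ∀ v, P y v = 0 → A v v ≤ β * P v v)
    (hdim : ∃ w ≠ 0, P y w = 0) : 0 ≤ P x (y - x) := by
  by_contra! hneg
  obtain ⟨d, rfl⟩ : ∃ d, y = x + d := ⟨y - x, by abel⟩
  rw [add_sub_cancel_left] at hneg
  have hMd : ∀ v, A d v - β * P d v = (β - α) * P x v := fun v => by
    have h1 := hgx v
    have h2 := hgy v
    simp only [map_add, LinearMap.add_apply] at h2
    linear_combination h2 - h1
  obtain ⟨w, hw, hyw⟩ := hdim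
  have hww := hy2 w hyw
  obtain ⟨s, v, rfl, hv⟩ : ∃ (s : ℝ) (v : V), w = s • d + v ∧ P x v = 0 := by
    refine ⟨P x w / P x d, w - (P x w / P x d) • d, by abel, ?_⟩
    rw [map_sub, map_smul, smul_eq_mul, div_mul_cancel₀ _ hneg.ne, sub_self]
  have hvv := hx2 v hv
  have hMv := hMd v
  have hMdd := hMd d
  rw [hv, mul_zero] at hMv
  simp only [map_add, map_smul, LinearMap.add_apply, LinearMap.smul_apply, smul_eq_mul] at hww
  rw [hA v d, hPs v d] at hww
  have hτ : 0 < (β - α) * P x d := mul_pos_of_neg_of_neg (by linarith) hneg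
  have key : s ^ 2 * ((β - α) * P x d) + (α - β) * P v v ≤ 0 := by
    rw [← hMdd]
    linear_combination hww + hvv - 2 * s * hMv
  have h1 : 0 ≤ s ^ 2 * ((β - α) * P x d) := by positivity
  by_cases hv0 : v = 0
  · subst hv0
    have hs : s ≠ 0 := by rintro rfl; simp at hw
    have : 0 < s ^ 2 * ((β - α) * P x d) := by positivity
    simp only [map_zero, mul_zero, add_zero] at key
    linarith
  · have := mul_pos (sub_pos.2 hβα) (hP v hv0)
    linarith

/-- In dimension at least two, local maximizers cannot have multipliers of opposite signs. -/
theorem eq_of_multipliers_opposite (hP : ∀ v, v ≠ 0 → 0 < P v v) (hPs : ∀ u v, P u v = P v u)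
    (hA : ∀ u v, A u v = A v u) {α β : ℝ} (hβα : β < α)
    (hgx : ∀ v, A x v + ℓ v = α * P x v) (hgy : ∀ v, A y v + ℓ v = β * P y v)
    (hx2 : ∀ v, P x v = 0 → α * P v v ≤ A v v) (hy2 : ∀ v, P y v = 0 → A v v ≤ β * P v v)
    (hdim : ∀ y, ∃ w ≠ 0, P y w = 0) : x = y := by
  have h1 := nonneg_of_multipliers_opposite hP hPs hA hβα hgx hgy hx2 hy2 (hdim y)
  have h2 := nonneg_of_multipliers_opposite (A := -A) (ℓ := -ℓ) (α := -β) (β := -α)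
    (x := y) (y := x) hP hPs
    (fun u v => by simp [hA u v]) (by linarith)
    (fun v => by simp only [LinearMap.neg_apply]; linarith [hgy v])
    (fun v => by simp only [LinearMap.neg_apply]; linarith [hgx v])
    (fun v hv => by simp only [LinearMap.neg_apply]; linarith [hy2 v hv])
    (fun v hv => by simp only [LinearMap.neg_apply]; linarith [hx2 v hv]) (hdim x)
  by_contra hne
  have h3 := hP (y - x) (sub_ne_zero.2 (Ne.symm hne))
  simp only [map_sub, LinearMap.sub_apply] at h1 h2 h3
  linarith

/-- At a local, nonglobal maximizer in dimension at least two the gradient of the constraint is a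
nonzero multiple of the gradient of the objective, with definite second order condition. -/
theorem IsPlanarLocalMax.exists_ne_zero_multiplier (hP : ∀ v, v ≠ 0 → 0 < P v v)
    (hPs : ∀ u v, P u v = P v u) (hA : ∀ u v, A u v = A v u)
    (hdim : ∀ f : V →ₗ[ℝ] ℝ, ∃ w ≠ 0, f w = 0)
    (h : IsPlanarLocalMax P (quadFun A ℓ c) x) (hx : quadFun A ℓ c x = 0)
    (hz : quadFun A ℓ c z = 0) (hzx : z ≠ x) :
    ∃ α : ℝ, α ≠ 0 ∧ (∀ v, A x v + ℓ v = α * P x v) ∧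
      ∀ v, P x v = 0 → 0 ≤ α * (A v v - α * P v v) := by
  obtain ⟨e₀, he₀⟩ : ∃ e, A x e + ℓ e ≠ 0 := by
    by_contra! hg
    exact hzx (h.eq_of_gradient_eq_zero hP hPs hA hx hg hz)
  obtain ⟨e, he⟩ : ∃ e, A x e + ℓ e = 1 := by
    refine ⟨(A x e₀ + ℓ e₀)⁻¹ • e₀, ?_⟩
    simp only [map_smul, smul_eq_mul]
    rw [← mul_add, inv_mul_cancel₀ he₀]
  obtain ⟨h1, h2⟩ := h.exists_multiplier hPs hA hx he
  set κ := P x e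
  have hκ : κ ≠ 0 := by
    intro h0
    obtain ⟨w, hw, hgw⟩ := hdim (A x + ℓ)
    have := h2 w hgw
    rw [h0, zero_mul] at this
    exact absurd (hP w hw) this.not_gt
  refine ⟨κ⁻¹, inv_ne_zero hκ, fun v => by rw [h1 v, inv_mul_cancel_left₀ hκ], fun v hv => ?_⟩
  have h3 : A x v + ℓ v = 0 := by
    rw [h1 v] at hv
    exact (mul_eq_zero.1 hv).resolve_left hκ
  have h4 := h2 v h3
  have h5 : κ⁻¹ * (A v v - κ⁻¹ * P v v) = (κ⁻¹) ^ 2 * (κ * A v v - P v v) := by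
    field_simp
  rw [h5]
  exact mul_nonneg (sq_nonneg _) (by linarith)

/-- A quadric through three collinear points contains the whole line. -/
theorem quadFun_eq_zero_of_collinear (hA : ∀ u v, A u v = A v u) {r : ℝ} {v : V}
    (hr0 : r ≠ 0) (hr1 : r ≠ 1) (hx : quadFun A ℓ c x = 0) (h1 : quadFun A ℓ c (x + v) = 0)
    (h2 : quadFun A ℓ c (x + r • v) = 0) (t : ℝ) : quadFun A ℓ c (x + t • v) = 0 := by
  rw [quadFun_add hA, hx] at h1 h2 ⊢
  simp only [map_smul, LinearMap.smul_apply, smul_eq_mul] at h2 ⊢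
  have h3 : r * (r - 1) * A v v = 0 := by linear_combination h2 - r * h1
  have h4 : A v v = 0 :=
    (mul_eq_zero.1 h3).resolve_left (mul_ne_zero hr0 (sub_ne_zero.2 hr1))
  linear_combination t * h1 + (t ^ 2 - t) * h4

theorem eq_of_isPlanarLocalMax_of_le (hP : ∀ v, v ≠ 0 → 0 < P v v) (hPs : ∀ u v, P u v = P v u)
    (hA : ∀ u v, A u v = A v u)
    (hx : quadFun A ℓ c x = 0) (hy : quadFun A ℓ c y = 0) (hz : quadFun A ℓ c z = 0)
    (hlx : IsPlanarLocalMax P (quadFun A ℓ c) x) (hly : IsPlanarLocalMax P (quadFun A ℓ c) y)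
    (hle : P y y ≤ P x x) (hlt : P x x < P z z) : x = y := by
  have hzx : z ≠ x := by rintro rfl; exact lt_irrefl _ hlt
  have hzy : z ≠ y := by rintro rfl; exact absurd hlt hle.not_gt
  by_cases hdim : ∀ f : V →ₗ[ℝ] ℝ, ∃ w ≠ 0, f w = 0
  · obtain ⟨α, hα, hgx, hx2⟩ := hlx.exists_ne_zero_multiplier hP hPs hA hdim hx hz hzx
    obtain ⟨β, hβ, hgy, hy2⟩ := hly.exists_ne_zero_multiplier hP hPs hA hdim hy hz hzy
    rcases hα.lt_or_gt with hα | hα <;> rcases hβ.lt_or_gt with hβ | hβ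
    · refine eq_of_multipliers_pos (A := -A) (ℓ := -ℓ) (c := -c) (α := -α) (β := -β) (z := z)
        hP hPs (fun u v => by simp [hA u v]) (by linarith) (by linarith) ?_ ?_ ?_
        (fun v => by simp only [LinearMap.neg_apply]; linarith [hgx v])
        (fun v => by simp only [LinearMap.neg_apply]; linarith [hgy v])
        (fun v hv => ?_) hle hlt
      · simp only [quadFun, LinearMap.neg_apply] at hx ⊢; linarith
      · simp only [quadFun, LinearMap.neg_apply] at hy ⊢; linarith
      · simp only [quadFun, LinearMap.neg_apply] at hz ⊢; linarith
      · have := nonpos_of_mul_nonneg_right (hy2 v hv) hβ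
        simp only [LinearMap.neg_apply]; linarith
    · refine (eq_of_multipliers_opposite hP hPs hA (hα.trans hβ) hgy hgx (fun v hv => ?_)
        (fun v hv => ?_) fun w => hdim (P w)).symm
      · linarith [nonneg_of_mul_nonneg_right (hy2 v hv) hβ]
      · linarith [nonpos_of_mul_nonneg_right (hx2 v hv) hα]
    · refine eq_of_multipliers_opposite hP hPs hA (hβ.trans hα) hgx hgy (fun v hv => ?_)
        (fun v hv => ?_) fun w => hdim (P w)
      · linarith [nonneg_of_mul_nonneg_right (hx2 v hv) hα]
      · linarith [nonpos_of_mul_nonneg_right (hy2 v hv) hβ]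
    · exact eq_of_multipliers_pos hP hPs hA hα hβ hx hy hz hgx hgy
        (fun v hv => by linarith [nonneg_of_mul_nonneg_right (hy2 v hv) hβ]) hle hlt
  · push Not at hdim
    obtain ⟨f, hf⟩ := hdim
    have hinj : ∀ w, f w = 0 → w = 0 := fun w hw => by
      by_contra h
      exact hf w h hw
    by_contra hne
    have hyx : y - x ≠ 0 := sub_ne_zero.2 (Ne.symm hne)
    have hfd : f (y - x) ≠ 0 := fun h => hyx (hinj _ h)
    have hzr : z - x = (f (z - x) / f (y - x)) • (y - x) := by
      refine sub_eq_zero.1 (hinj _ ?_)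
      rw [map_sub, map_smul, smul_eq_mul, div_mul_cancel₀ _ hfd, sub_self]
    set r := f (z - x) / f (y - x)
    refine hlx.not_line hP hPs hyx
      (quadFun_eq_zero_of_collinear hA (r := r) ?_ ?_ hx ?_ ?_)
    · intro h0
      rw [h0, zero_smul] at hzr
      exact hzx (sub_eq_zero.1 hzr)
    · intro h0
      rw [h0, one_smul] at hzr
      exact hzy (sub_left_injective hzr)
    · rwa [add_sub_cancel]
    · rwa [← hzr, add_sub_cancel]

/-- A quadric carries at most one local, nonglobal maximizer of a positive definite form. -/
theorem eq_of_isPlanarLocalMax (hP : ∀ v, v ≠ 0 → 0 < P v v) (hPs : ∀ u v, P u v = P v u)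
    (hA : ∀ u v, A u v = A v u) {z' : V}
    (hx : quadFun A ℓ c x = 0) (hy : quadFun A ℓ c y = 0)
    (hlx : IsPlanarLocalMax P (quadFun A ℓ c) x) (hly : IsPlanarLocalMax P (quadFun A ℓ c) y)
    (hz : quadFun A ℓ c z = 0) (hzx : P x x < P z z)
    (hz' : quadFun A ℓ c z' = 0) (hzy : P y y < P z' z') : x = y := by
  rcases le_total (P y y) (P x x) with hle | hle
  · exact eq_of_isPlanarLocalMax_of_le hP hPs hA hx hy hz hlx hly hle hzx
  · exact (eq_of_isPlanarLocalMax_of_le hP hPs hA hy hx hz' hly hlx hle hzy).symm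

end QuadricCriticalPoints

theorem exists_euclNorm_lt {n : ℕ} (v e : Fin n → ℝ) {δ : ℝ} (hδ : 0 < δ) :
    ∃ η > (0 : ℝ), ∀ t s : ℝ, |t| < η → |s| < η → euclNorm (t • v + s • e) < δ := by
  have hc : Continuous fun p : ℝ × ℝ => euclNorm (p.1 • v + p.2 • e) := by
    unfold euclNorm dotProduct
    fun_prop
  have h0 : euclNorm ((0 : ℝ × ℝ).1 • v + (0 : ℝ × ℝ).2 • e) < δ := by
    simpa [euclNorm] using hδ
  obtain ⟨η, hη, H⟩ := Metric.eventually_nhds_iff.1 (hc.continuousAt.eventually (gt_mem_nhds h0))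
  refine ⟨η, hη, fun t s ht hs => H (y := (t, s)) ?_⟩
  simp [ht, hs]

theorem stmt17 {n : ℕ} (hn : 1 ≤ n)
    (A0 A1 : Matrix (Fin n) (Fin n) ℝ) (hA0 : A0.IsSymm) (hA1 : A1.IsSymm)
    (b0 b1 : Fin n → ℝ) (c1 : ℝ)
    (hjoint : ∃ μ1 : ℝ, (-(A0 + μ1 • A1)).PosDef) :
    ∀ x y : Fin n → ℝ, IsLNGMinGTRE A0 A1 b0 b1 c1 x →
      IsLNGMinGTRE A0 A1 b0 b1 c1 y → x = y := by
  obtain ⟨μ, hμ⟩ := hjoint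
  set M : Matrix (Fin n) (Fin n) ℝ := -(A0 + μ • A1) with hM
  set P : (Fin n → ℝ) →ₗ[ℝ] (Fin n → ℝ) →ₗ[ℝ] ℝ := Matrix.toLinearMap₂' ℝ M
  set A : (Fin n → ℝ) →ₗ[ℝ] (Fin n → ℝ) →ₗ[ℝ] ℝ := Matrix.toLinearMap₂' ℝ A1
  have Pap : ∀ u v, P u v = u ⬝ᵥ M *ᵥ v := fun u v => Matrix.toLinearMap₂'_apply' M u v
  have Aap : ∀ u v, A u v = u ⬝ᵥ A1 *ᵥ v := fun u v => Matrix.toLinearMap₂'_apply' A1 u v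
  have symm_form : ∀ N : Matrix (Fin n) (Fin n) ℝ, N.IsSymm → ∀ u v : Fin n → ℝ,
      u ⬝ᵥ N *ᵥ v = v ⬝ᵥ N *ᵥ u := fun N hN u v => by
    rw [dotProduct_mulVec, ← mulVec_transpose, hN.eq, dotProduct_comm]
  have hMs : M.IsSymm := (hA0.add (hA1.smul μ)).neg
  have hPs : ∀ u v, P u v = P v u := fun u v => by rw [Pap, Pap, symm_form M hMs]
  have hAs : ∀ u v, A u v = A v u := fun u v => by rw [Aap, Aap, symm_form A1 hA1]
  have hPpos : ∀ v, v ≠ 0 → 0 < P v v := fun v hv => by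
    rw [Pap]
    simpa using hμ.dotProduct_mulVec_pos hv
  -- center of the concave function `f₀ + μ f₁`
  obtain ⟨p, hp⟩ : ∃ p, M *ᵥ p = b0 + μ • b1 :=
    ⟨M⁻¹ *ᵥ (b0 + μ • b1), by
      rw [mulVec_mulVec, Matrix.mul_nonsing_inv _ hμ.det_pos.ne'.isUnit, one_mulVec]⟩
  set ℓ : (Fin n → ℝ) →ₗ[ℝ] ℝ := A p + dotProductBilin ℝ ℝ b1
  have hℓ' : ∀ w, ℓ w = A p w + b1 ⬝ᵥ w := fun w => rfl
  have hq : ∀ w, qf1 A1 b1 c1 (p + w) = quadFun A ℓ (qf1 A1 b1 c1 p) w := fun w => by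
    simp only [qf1, quadFun, ← Aap, hℓ', map_add, LinearMap.add_apply, dotProduct_add]
    linear_combination hAs w p
  have hf : ∃ k : ℝ, ∀ w, qf0 A0 b0 (p + w) + μ * qf1 A1 b1 c1 (p + w) = k - P w w := by
    have h1 : ∀ w, qf0 A0 b0 w + μ * qf1 A1 b1 c1 w = -P w w + 2 * P p w + μ * c1 := fun w => by
      rw [hPs p w, Pap, Pap, hp]
      simp only [hM, qf0, qf1, neg_mulVec, add_mulVec, smul_mulVec, dotProduct_neg, dotProduct_add,
        dotProduct_smul, smul_eq_mul, dotProduct_comm w b0, dotProduct_comm w b1]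
      ring
    refine ⟨P p p + μ * c1, fun w => ?_⟩
    rw [h1]
    simp only [map_add, LinearMap.add_apply]
    linear_combination -hPs w p
  obtain ⟨k, hf⟩ := hf
  have hval : ∀ w, qf1 A1 b1 c1 (p + w) = 0 → qf0 A0 b0 (p + w) = k - P w w := fun w hw => by
    have := hf w
    rw [hw] at this
    linarith
  have transfer : ∀ x, IsLNGMinGTRE A0 A1 b0 b1 c1 (p + x) →
      quadFun A ℓ (qf1 A1 b1 c1 p) x = 0 ∧
      IsPlanarLocalMax P (quadFun A ℓ (qf1 A1 b1 c1 p)) x ∧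
      ∃ z, quadFun A ℓ (qf1 A1 b1 c1 p) z = 0 ∧ P x x < P z z := by
    rintro x ⟨⟨hx, δ, hδ, hloc⟩, hng⟩
    refine ⟨by rw [← hq, hx], fun v e => ?_, ?_⟩
    · obtain ⟨η, hη, H⟩ := exists_euclNorm_lt v e hδ
      refine ⟨η, hη, fun t s ht hs h0 => ?_⟩
      rw [← hq] at h0
      have h1 := hloc _ h0 (by
        rw [show p + (x + t • v + s • e) - (p + x) = t • v + s • e by abel]
        exact H t s ht hs)
      rw [hval _ hx, hval _ h0] at h1
      linarith
    · simp only [IsGlobalMinGTRE, not_and, not_forall, not_le] at hng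
      obtain ⟨z, hz, hlt⟩ := hng hx
      obtain ⟨z, rfl⟩ : ∃ z', z = p + z' := ⟨z - p, by abel⟩
      refine ⟨z, by rw [← hq, hz], ?_⟩
      rw [hval _ hx, hval _ hz] at hlt
      linarith
  intro x y hx hy
  obtain ⟨x, rfl⟩ : ∃ x', x = p + x' := ⟨x - p, by abel⟩
  obtain ⟨y, rfl⟩ : ∃ y', y = p + y' := ⟨y - p, by abel⟩
  obtain ⟨hx0, hxl, z, hz, hxz⟩ := transfer x hx
  obtain ⟨hy0, hyl, z', hz', hyz⟩ := transfer y hy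
  rw [eq_of_isPlanarLocalMax hPpos hPs hAs hx0 hy0 hxl hyl hz hxz hz' hyz]
end
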